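/- Let Φ be a Young function satisfying the Δ2-condition. A convex set C ⊂ L_{Φ*} is σ(L_{Φ*},L_Φ)-closed if and only if for every 0 ≤ ζ ∈ L_{Φ*} the intersection C ∩ [−ζ,ζ] with the order interval is closed for the topology of convergence in probability (i.e. C is order closed). -/

import Mathlib

open MeasureTheory Filter Topology Set
open scoped ENNReal

noncomputable section

namespace OrliczPaper

variable {Ω : Type*} [MeasurableSpace Ω]

/-- A (finite, coercive) Young function: an even convex function with `Φ 0 = 0`
and `Φ x / x → ∞` as `x → ∞`. -/
structure IsYoung (Φ : ℝ → ℝ) : Prop where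
  even : ∀ x, Φ (-x) = Φ x
  convexOn : ConvexOn ℝ Set.univ Φ
  map_zero : Φ 0 = 0
  coercive : Tendsto (fun x => Φ x / x) atTop atTop

/-- The Δ₂-condition: `limsup_{x→∞} Φ(2x)/Φ(x) < ∞`, i.e. `Φ(2x) ≤ C Φ(x)`
for all large `x`. -/
def Delta2 (Φ : ℝ → ℝ) : Prop :=
  ∃ C x₀ : ℝ, ∀ x ≥ x₀, Φ (2 * x) ≤ C * Φ x

/-- The conjugate Young function `Φ*(y) = sup_x (x y − Φ x)`. -/
def conj (Φ : ℝ → ℝ) (y : ℝ) : ℝ := ⨆ x : ℝ, x * y - Φ x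

variable (P : Measure Ω)

/-- Membership in the Orlicz space `L_Φ`: a measurable function with
`E[Φ(l ξ)] < ∞` for some `l > 0`. -/
def MemOrlicz (Φ : ℝ → ℝ) (f : Ω → ℝ) : Prop :=
  Measurable f ∧ ∃ l : ℝ, 0 < l ∧ ∫⁻ ω, ENNReal.ofReal (Φ (l * f ω)) ∂P < ⊤

/-- The Orlicz space `L_Φ`, as a set of (everywhere defined) measurable functions. -/
def Orlicz (Φ : ℝ → ℝ) : Set (Ω → ℝ) := {f | MemOrlicz P Φ f}

/-- The Luxemburg norm `‖f‖_Φ = inf {l > 0 : E[Φ(f/l)] ≤ 1}`. -/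
def luxNorm (Φ : ℝ → ℝ) (f : Ω → ℝ) : ℝ :=
  sInf {l : ℝ | 0 < l ∧ ∫⁻ ω, ENNReal.ofReal (Φ (f ω / l)) ∂P ≤ 1}

/-- The Orlicz (dual) norm `‖f‖_{(Φ*)} = sup {E[g f] : E[Φ(g)] ≤ 1}`
(the Young function `Φ` here is the one of the *predual*). -/
def orliczNorm (Φ : ℝ → ℝ) (f : Ω → ℝ) : ℝ :=
  sSup {r : ℝ | ∃ g : Ω → ℝ, Measurable g ∧
    (∫⁻ ω, ENNReal.ofReal (Φ (g ω)) ∂P) ≤ 1 ∧ r = ∫ ω, g ω * f ω ∂P}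

/-- The bilinear pairing `⟨f, g⟩ = E[f g]`. -/
def pairing (f g : Ω → ℝ) : ℝ := ∫ ω, f ω * g ω ∂P

/-- The weak topology `σ(E, F)` on `E` induced by the pairing with `F`. -/
def weakT (E F : Set (Ω → ℝ)) : TopologicalSpace E :=
  TopologicalSpace.induced
    (fun ξ : E => fun η : F => pairing P (ξ : Ω → ℝ) (η : Ω → ℝ)) inferInstance

/-- The absolutely convex (convex and balanced) `σ(F,E)`-compact subsets of `F`. -/
def dualSets (E F : Set (Ω → ℝ)) : Set (Set F) :=
  {A | Convex ℝ (Subtype.val '' A) ∧ Balanced ℝ (Subtype.val '' A) ∧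
    @IsCompact _ (weakT P F E) A}

/-- The Mackey topology `τ(E, F)`: the topology on `E` of uniform convergence on
absolutely convex `σ(F,E)`-compact subsets of `F`. -/
def mackeyT (E F : Set (Ω → ℝ)) : TopologicalSpace E :=
  TopologicalSpace.induced
    (fun ξ : E => UniformOnFun.ofFun (dualSets P E F)
      (fun η : F => pairing P (ξ : Ω → ℝ) (η : Ω → ℝ)))
    inferInstance

/-- A distance generating the topology of convergence in `P`-probability. -/
def probDist (f g : Ω → ℝ) : ℝ := ∫ ω, min |f ω - g ω| 1 ∂P

/-- The topology of convergence in probability, restricted to `E ⊆ L₀`. -/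
def probT (E : Set (Ω → ℝ)) : TopologicalSpace E :=
  TopologicalSpace.generateFrom
    {U | ∃ f : E, ∃ ε : ℝ, 0 < ε ∧ U = {g : E | probDist P (f : Ω → ℝ) (g : Ω → ℝ) < ε}}

/-- `L_∞`: essentially bounded measurable functions. -/
def Linf : Set (Ω → ℝ) := {f | Measurable f ∧ ∃ C : ℝ, ∀ᵐ ω ∂P, |f ω| ≤ C}

/-- `L_1`: integrable measurable functions. -/
def L1 : Set (Ω → ℝ) := {f | Measurable f ∧ Integrable f P}

/-- The essential supremum norm. -/
def linfNorm (f : Ω → ℝ) : ℝ := sInf {C : ℝ | 0 ≤ C ∧ ∀ᵐ ω ∂P, |f ω| ≤ C}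

/-- Uniform integrability of a set of functions:
`sup_{f ∈ A} E[|f| 1_{|f| > N}] → 0`. -/
def UnifInt (A : Set (Ω → ℝ)) : Prop :=
  Tendsto (fun N : ℕ => ⨆ f ∈ A, ∫⁻ ω in {ω | (N : ℝ) < |f ω|}, ENNReal.ofReal |f ω| ∂P)
    atTop (𝓝 0)

/-- Uniform integrability of a sequence of functions. -/
def UnifIntSeq (g : ℕ → Ω → ℝ) : Prop :=
  Tendsto (fun N : ℕ => ⨆ n, ∫⁻ ω in {ω | (N : ℝ) < |g n ω|}, ENNReal.ofReal |g n ω| ∂P)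
    atTop (𝓝 0)

/-- The Cesàro means of a sequence of functions: `cesaro ξ N` is the average of
`ξ 0, …, ξ N`. -/
def cesaro (ξ : ℕ → Ω → ℝ) (N : ℕ) : Ω → ℝ :=
  fun ω => (∑ i ∈ Finset.range (N + 1), ξ i ω) / (N + 1)

/-- `sup_n |ξ n| ∈ L_Φ` (order boundedness of the sequence `ξ` in `L_Φ`). -/
def supMem (Φ : ℝ → ℝ) (ξ : ℕ → Ω → ℝ) : Prop :=
  (∀ᵐ ω ∂P, BddAbove (Set.range fun n => |ξ n ω|)) ∧
    MemOrlicz P Φ (fun ω => ⨆ n, |ξ n ω|)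

/-- `ξb` is a sequence of forward convex combinations of `ξ`:
`ξb n ∈ conv (ξ k ; k ≥ n)`. -/
def FwdConvComb (ξ ξb : ℕ → Ω → ℝ) : Prop :=
  ∀ n, ξb n ∈ convexHull ℝ {g : Ω → ℝ | ∃ k ≥ n, g = ξ k}

/-- The left derivative of a convex function. -/
def leftDeriv (Φ : ℝ → ℝ) (y : ℝ) : ℝ :=
  ⨆ h : {h : ℝ // 0 < h}, (Φ y - Φ (y - (h : ℝ))) / (h : ℝ)

/-- `p_Φ(x) = sup_{y > x} y Φ'(y) / Φ(y)`. -/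
def pPhiAt (Φ : ℝ → ℝ) (x : ℝ) : ℝ≥0∞ :=
  ⨆ y : {y : ℝ // x < y}, ENNReal.ofReal ((y : ℝ) * leftDeriv Φ (y : ℝ) / Φ (y : ℝ))

/-- `p_Φ = inf_{x ≥ 0} p_Φ(x)`. -/
def pPhi (Φ : ℝ → ℝ) : ℝ≥0∞ := ⨅ x : {x : ℝ // 0 ≤ x}, pPhiAt Φ x

/-- `q_Φ = p_Φ / (p_Φ − 1)` (with `1/0 = ∞`). -/
def qPhi (Φ : ℝ → ℝ) : ℝ≥0∞ := pPhi Φ / (pPhi Φ - 1)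

end OrliczPaper

namespace OrliczPaper

/-- Even convex functions on the line that vanish at the origin. -/
structure IsEvenConvex (f : ℝ → ℝ) : Prop where
  even : ∀ x, f (-x) = f x
  convexOn : ConvexOn ℝ Set.univ f
  map_zero : f 0 = 0

section RealFunctions

variable {f Φ : ℝ → ℝ}

lemma IsYoung.isEvenConvex (h : IsYoung Φ) : IsEvenConvex Φ :=
  ⟨h.even, h.convexOn, h.map_zero⟩

lemma IsEvenConvex.map_abs (h : IsEvenConvex f) (x : ℝ) : f |x| = f x := by
  rcases abs_choice x with hx | hx <;> rw [hx]
  exact h.even x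

lemma IsEvenConvex.map_midpoint_le (h : IsEvenConvex f) (x y : ℝ) :
    f ((x + y) / 2) ≤ (f x + f y) / 2 := by
  have := h.convexOn.2 (mem_univ x) (mem_univ y) (by norm_num : (0 : ℝ) ≤ 1 / 2)
    (by norm_num : (0 : ℝ) ≤ 1 / 2) (by norm_num)
  simp only [smul_eq_mul] at this
  rw [show (x + y) / 2 = 1 / 2 * x + 1 / 2 * y by ring]
  linarith

lemma IsEvenConvex.nonneg (h : IsEvenConvex f) (x : ℝ) : 0 ≤ f x := by
  have := h.map_midpoint_le x (-x)
  rw [h.even, add_neg_cancel, zero_div, h.map_zero] at this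
  linarith

lemma IsEvenConvex.map_mul_le (h : IsEvenConvex f) {t : ℝ} (ht : 0 ≤ t) (ht1 : t ≤ 1) (x : ℝ) :
    f (t * x) ≤ t * f x := by
  have := h.convexOn.2 (mem_univ x) (mem_univ 0) ht (sub_nonneg.2 ht1) (by ring)
  simpa [h.map_zero] using this

lemma IsEvenConvex.mono_abs (h : IsEvenConvex f) {x y : ℝ} (hxy : |x| ≤ |y|) : f x ≤ f y := by
  rw [← h.map_abs x, ← h.map_abs y]
  rcases (abs_nonneg y).eq_or_lt with hy | hy
  · have hx : |x| = 0 := le_antisymm (hy ▸ hxy) (abs_nonneg x)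
    rw [hx, ← hy]
  · have h1 : |x| / |y| ≤ 1 := (div_le_one hy).2 hxy
    have := h.map_mul_le (by positivity : 0 ≤ |x| / |y|) h1 |y|
    rw [div_mul_cancel₀ _ hy.ne'] at this
    exact this.trans (mul_le_of_le_one_left (h.nonneg _) h1)

lemma IsEvenConvex.continuous (h : IsEvenConvex f) : Continuous f :=
  continuousOn_univ.1 (h.convexOn.continuousOn isOpen_univ)

lemma IsYoung.bddAbove_conj (h : IsYoung Φ) (y : ℝ) :
    BddAbove (range fun x : ℝ => x * y - Φ x) := by
  obtain ⟨R, hR⟩ := eventually_atTop.1 (h.coercive.eventually_ge_atTop |y|)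
  refine ⟨max R 1 * |y|, ?_⟩
  rintro _ ⟨x, rfl⟩
  have hxy : x * y ≤ |x| * |y| := by rw [← abs_mul]; exact le_abs_self _
  have hΦ := h.isEvenConvex.nonneg x
  dsimp only
  rcases le_total |x| (max R 1) with hx | hx
  · nlinarith [mul_le_mul_of_nonneg_right hx (abs_nonneg y)]
  · have h1 : (0 : ℝ) < |x| := lt_of_lt_of_le (by positivity) hx
    have := hR |x| ((le_max_left _ _).trans hx)
    rw [le_div_iff₀ h1, h.isEvenConvex.map_abs] at this
    have : 0 ≤ max R 1 * |y| := by positivity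
    nlinarith

/-- Young's inequality. -/
lemma IsYoung.mul_sub_le_conj (h : IsYoung Φ) (x y : ℝ) : x * y - Φ x ≤ conj Φ y :=
  le_ciSup (h.bddAbove_conj y) x

lemma conj_le {y c : ℝ} (hc : ∀ x, x * y - Φ x ≤ c) : conj Φ y ≤ c := ciSup_le hc

lemma IsYoung.isEvenConvex_conj (h : IsYoung Φ) : IsEvenConvex (conj Φ) where
  even y := by
    have key : ∀ y, conj Φ (-y) ≤ conj Φ y := fun y => conj_le fun x => by
      have := h.mul_sub_le_conj (-x) y
      rw [h.even] at this
      linarith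
    refine le_antisymm (key y) ?_
    simpa using key (-y)
  convexOn := by
    refine ⟨convex_univ, fun x _ y _ a b ha hb hab => conj_le fun z => ?_⟩
    have h1 := mul_le_mul_of_nonneg_left (h.mul_sub_le_conj z x) ha
    have h2 := mul_le_mul_of_nonneg_left (h.mul_sub_le_conj z y) hb
    have h3 : Φ z = a * Φ z + b * Φ z := by rw [← add_mul, hab, one_mul]
    simp only [smul_eq_mul]
    linarith
  map_zero := by
    refine le_antisymm (conj_le fun x => ?_) ?_
    · have := h.isEvenConvex.nonneg x
      linarith
    · simpa [h.map_zero] using h.mul_sub_le_conj 0 0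

lemma IsYoung.abs_mul_le (h : IsYoung Φ) (x y : ℝ) : |x * y| ≤ Φ x + conj Φ y := by
  rw [abs_mul]
  have := h.mul_sub_le_conj |x| |y|
  rw [h.isEvenConvex.map_abs, h.isEvenConvex_conj.map_abs] at this
  linarith

lemma IsYoung.abs_le_conj_add (h : IsYoung Φ) (y : ℝ) : |y| ≤ conj Φ y + Φ 1 := by
  have := h.abs_mul_le 1 y
  rw [one_mul] at this
  linarith

lemma IsYoung.exists_map_two_mul_le (h : IsYoung Φ) (hΔ : Delta2 Φ) :
    ∃ M : ℕ, 1 ≤ M ∧ ∃ D : ℝ, 0 ≤ D ∧ ∀ x, Φ (2 * x) ≤ 2 * M * Φ x + D := by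
  obtain ⟨K, x₀, hK⟩ := hΔ
  obtain ⟨M, hM⟩ := exists_nat_ge (max K 1)
  have hE := h.isEvenConvex
  refine ⟨M, by exact_mod_cast (le_max_right _ _).trans hM, Φ (2 * x₀), hE.nonneg _, fun x => ?_⟩
  have hKM : K ≤ M := (le_max_left _ _).trans hM
  have hx0 := hE.nonneg x
  rcases le_total x₀ |x| with hx | hx
  · have := hK |x| hx
    rw [show 2 * |x| = |2 * x| by simp [abs_mul], hE.map_abs, hE.map_abs] at this
    have h2 : K * Φ x ≤ 2 * M * Φ x := by
      refine mul_le_mul_of_nonneg_right ?_ hx0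
      have : (0 : ℝ) ≤ M := Nat.cast_nonneg M
      linarith
    linarith [hE.nonneg (2 * x₀)]
  · have : Φ (2 * x) ≤ Φ (2 * x₀) := hE.mono_abs (by
      rw [abs_mul, abs_mul]
      exact mul_le_mul_of_nonneg_left (hx.trans (le_abs_self _)) (abs_nonneg _))
    have : 0 ≤ 2 * M * Φ x := by positivity
    linarith

/-- The dual form of the `Δ₂`-condition, iterated. -/
lemma IsYoung.exists_conj_div_pow_le (h : IsYoung Φ) (hΔ : Delta2 Φ) :
    ∃ M : ℕ, 1 ≤ M ∧ ∃ D : ℝ, 0 ≤ D ∧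
      ∀ (k : ℕ) (u : ℝ), conj Φ (u / M ^ k) ≤ conj Φ u / (2 * M) ^ k + D := by
  obtain ⟨M, hM, D, hD, hMD⟩ := h.exists_map_two_mul_le hΔ
  have hM' : (1 : ℝ) ≤ M := by exact_mod_cast hM
  have hstep : ∀ u, conj Φ (u / M) ≤ (conj Φ u + D) / (2 * M) := fun u => conj_le fun x => by
    have h1 := h.mul_sub_le_conj (2 * x) u
    have h2 := hMD x
    rw [le_div_iff₀ (by positivity)]
    have h3 : (x * (u / M) - Φ x) * (2 * M) = 2 * x * u - 2 * M * Φ x := by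
      field_simp
    rw [h3]
    linarith
  refine ⟨M, hM, D, hD, fun k => ?_⟩
  induction k with
  | zero => intro u; simpa using hD
  | succ k ih =>
    intro u
    have h1 := hstep (u / M ^ k)
    have h2 := ih u
    rw [div_div, ← pow_succ] at h1
    refine h1.trans ?_
    rw [pow_succ (2 * (M : ℝ)), ← div_div (conj Φ u)]
    have hq : (conj Φ (u / M ^ k) + D) / (2 * M) ≤
        (conj Φ u / (2 * M) ^ k + 2 * D) / (2 * M) :=
      div_le_div_of_nonneg_right (by linarith) (by positivity)
    have hr : 2 * D / (2 * M) ≤ D := by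
      rw [div_le_iff₀ (by positivity)]
      nlinarith
    rw [add_div (conj Φ u / _)] at hq
    exact hq.trans (add_le_add_right hr _)

end RealFunctions

section OrliczSpace

variable {Ω : Type*} [MeasurableSpace Ω] {P : Measure Ω} {f Φ : ℝ → ℝ} {g g' η ξ ζ : Ω → ℝ}

lemma IsEvenConvex.measurable_ofReal_comp (h : IsEvenConvex f) (hg : Measurable g) :
    Measurable fun ω => ENNReal.ofReal (f (g ω)) :=
  (h.continuous.measurable.comp hg).ennreal_ofReal

lemma IsEvenConvex.integrable_comp (h : IsEvenConvex f) (hg : Measurable g)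
    (hfin : ∫⁻ ω, ENNReal.ofReal (f (g ω)) ∂P < ⊤) : Integrable (fun ω => f (g ω)) P :=
  (lintegral_ofReal_ne_top_iff_integrable
    (h.continuous.measurable.comp hg).aestronglyMeasurable
    (Eventually.of_forall fun _ => h.nonneg _)).1 hfin.ne

lemma IsEvenConvex.memOrlicz_of_abs_le (h : IsEvenConvex f) (hζ : MemOrlicz P f ζ)
    (hg : Measurable g) (hle : ∀ᵐ ω ∂P, |g ω| ≤ ζ ω) : MemOrlicz P f g := by
  obtain ⟨-, l, hl, hfin⟩ := hζ
  refine ⟨hg, l, hl, lt_of_le_of_lt (lintegral_mono_ae ?_) hfin⟩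
  filter_upwards [hle] with ω hω
  refine ENNReal.ofReal_le_ofReal (h.mono_abs ?_)
  rw [abs_mul, abs_mul]
  exact mul_le_mul_of_nonneg_left (hω.trans (le_abs_self _)) (abs_nonneg _)

lemma IsEvenConvex.memOrlicz_abs (h : IsEvenConvex f) (hg : MemOrlicz P f g) :
    MemOrlicz P f fun ω => |g ω| := by
  obtain ⟨hm, l, hl, hfin⟩ := hg
  refine ⟨hm.abs, l, hl, ?_⟩
  convert hfin using 4 with ω
  rw [← h.map_abs (l * g ω), abs_mul, abs_of_pos hl]

lemma IsEvenConvex.memOrlicz_add (h : IsEvenConvex f) (hg : MemOrlicz P f g)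
    (hg' : MemOrlicz P f g') : MemOrlicz P f (g + g') := by
  obtain ⟨hm, l, hl, hfin⟩ := hg
  obtain ⟨hm', l', hl', hfin'⟩ := hg'
  refine ⟨hm.add hm', min l l' / 2, by positivity, ?_⟩
  refine lt_of_le_of_lt (lintegral_mono fun ω => ?_) ((lintegral_add_left
    (h.measurable_ofReal_comp (hm.const_mul l)) _).trans_lt (ENNReal.add_lt_top.2 ⟨hfin, hfin'⟩))
  rw [← ENNReal.ofReal_add (h.nonneg _) (h.nonneg _)]
  refine ENNReal.ofReal_le_ofReal ?_
  have h0 : 0 < min l l' := lt_min hl hl'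
  have h1 : f (min l l' * g ω) ≤ f (l * g ω) := h.mono_abs (by
    rw [abs_mul, abs_mul, abs_of_pos h0, abs_of_pos hl]
    exact mul_le_mul_of_nonneg_right (min_le_left _ _) (abs_nonneg _))
  have h2 : f (min l l' * g' ω) ≤ f (l' * g' ω) := h.mono_abs (by
    rw [abs_mul, abs_mul, abs_of_pos h0, abs_of_pos hl']
    exact mul_le_mul_of_nonneg_right (min_le_right _ _) (abs_nonneg _))
  have h3 := h.map_midpoint_le (min l l' * g ω) (min l l' * g' ω)
  have h4 := h.nonneg (l * g ω)
  have h5 := h.nonneg (l' * g' ω)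
  rw [show min l l' / 2 * (g + g') ω = (min l l' * g ω + min l l' * g' ω) / 2 by
    simp only [Pi.add_apply]; ring]
  linarith

lemma IsEvenConvex.memOrlicz_neg (h : IsEvenConvex f) (hg : MemOrlicz P f g) :
    MemOrlicz P f (-g) := by
  obtain ⟨hm, l, hl, hfin⟩ := hg
  exact ⟨hm.neg, l, hl, by simpa [h.even] using hfin⟩

lemma memOrlicz_const_mul {t : ℝ} (ht : 0 < t) (hg : MemOrlicz P f g) :
    MemOrlicz P f fun ω => t * g ω := by
  obtain ⟨hm, l, hl, hfin⟩ := hg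
  refine ⟨hm.const_mul t, l / t, by positivity, ?_⟩
  convert hfin using 5 with ω
  field_simp

/-- Hölder's inequality for the duality between `L_Φ` and `L_{Φ*}`. -/
lemma IsYoung.integrable_mul (h : IsYoung Φ) (hξ : MemOrlicz P (conj Φ) ξ)
    (hη : MemOrlicz P Φ η) : Integrable (fun ω => ξ ω * η ω) P := by
  obtain ⟨hm, l, hl, hfin⟩ := hξ
  obtain ⟨hm', l', hl', hfin'⟩ := hη
  have h1 := h.isEvenConvex_conj.integrable_comp (hm.const_mul l) hfin
  have h2 := h.isEvenConvex.integrable_comp (hm'.const_mul l') hfin'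
  refine ((h2.add h1).const_mul (l * l')⁻¹).mono' (hm.mul hm').aestronglyMeasurable
    (Eventually.of_forall fun ω => ?_)
  have := h.abs_mul_le (l' * η ω) (l * ξ ω)
  rw [show l' * η ω * (l * ξ ω) = (l * l') * (ξ ω * η ω) by ring, abs_mul,
    abs_of_pos (mul_pos hl hl')] at this
  rw [Real.norm_eq_abs, inv_mul_eq_div, le_div_iff₀ (mul_pos hl hl'), mul_comm]
  exact this

/-- A uniform bound for the pairing of a fixed element of `L_{Φ*}` with the modular unit ball. -/
lemma IsYoung.exists_integral_abs_mul_le (h : IsYoung Φ) (hξ : MemOrlicz P (conj Φ) ξ) :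
    ∃ c : ℝ, 0 ≤ c ∧ ∀ η : Ω → ℝ, Measurable η → ∫⁻ ω, ENNReal.ofReal (Φ (η ω)) ∂P ≤ 1 →
      ∫ ω, |ξ ω * η ω| ∂P ≤ c := by
  obtain ⟨hm, l, hl, hfin⟩ := hξ
  have h1 := h.isEvenConvex_conj.integrable_comp (hm.const_mul l) hfin
  refine ⟨(1 + ∫ ω, conj Φ (l * ξ ω) ∂P) / l, ?_, fun η hη hη1 => ?_⟩
  · have : 0 ≤ ∫ ω, conj Φ (l * ξ ω) ∂P := integral_nonneg fun ω => h.isEvenConvex_conj.nonneg _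
    positivity
  have h2 := h.isEvenConvex.integrable_comp hη (hη1.trans_lt ENNReal.one_lt_top)
  have h3 : ∫ ω, Φ (η ω) ∂P ≤ 1 := by
    rw [integral_eq_lintegral_of_nonneg_ae (Eventually.of_forall fun ω => h.isEvenConvex.nonneg _)
      h2.aestronglyMeasurable]
    exact ENNReal.toReal_le_of_le_ofReal zero_le_one (by simpa using hη1)
  rw [le_div_iff₀ hl, ← integral_mul_const]
  refine (integral_mono_of_nonneg (Eventually.of_forall fun ω => by positivity) (h2.add h1)
    (Eventually.of_forall fun ω => ?_)).trans ?_
  · have := h.abs_mul_le (η ω) (l * ξ ω)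
    rw [show η ω * (l * ξ ω) = (ξ ω * η ω) * l by ring, abs_mul, abs_of_pos hl] at this
    exact this
  · simp only [Pi.add_apply]
    rw [integral_add h2 h1]
    linarith

lemma IsYoung.integrable [IsFiniteMeasure P] (h : IsYoung Φ) (hξ : MemOrlicz P (conj Φ) ξ) :
    Integrable ξ P := by
  have := h.integrable_mul (η := fun _ => 1) hξ
    ⟨measurable_const, 1, one_pos, by
      rw [lintegral_const]
      exact ENNReal.mul_lt_top ENNReal.ofReal_lt_top (measure_lt_top _ _)⟩
  simpa using this

lemma IsYoung.integral_abs_le [IsProbabilityMeasure P] (h : IsYoung Φ) {r : ℝ} (hr : 0 < r)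
    (hm : Measurable ξ) (hξ : ∫⁻ ω, ENNReal.ofReal (conj Φ (ξ ω / r)) ∂P ≤ 1) :
    ∫ ω, |ξ ω| ∂P ≤ r * (1 + Φ 1) := by
  have h1 := h.isEvenConvex_conj.integrable_comp (hm.div_const r) (hξ.trans_lt ENNReal.one_lt_top)
  have h3 : ∫ ω, conj Φ (ξ ω / r) ∂P ≤ 1 := by
    rw [integral_eq_lintegral_of_nonneg_ae
      (Eventually.of_forall fun ω => h.isEvenConvex_conj.nonneg _) h1.aestronglyMeasurable]
    exact ENNReal.toReal_le_of_le_ofReal zero_le_one (by simpa using hξ)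
  refine (integral_mono_of_nonneg (Eventually.of_forall fun ω => abs_nonneg _)
    ((h1.add (integrable_const (Φ 1))).const_mul r) (Eventually.of_forall fun ω => ?_)).trans ?_
  · have := h.abs_le_conj_add (ξ ω / r)
    rw [abs_div, abs_of_pos hr, div_le_iff₀ hr, mul_comm] at this
    exact this
  · rw [integral_const_mul]
    simp only [Pi.add_apply]
    rw [integral_add h1 (integrable_const _)]
    simp only [integral_const, probReal_univ, one_smul]
    exact mul_le_mul_of_nonneg_left (by linarith) hr.le

/-- Closedness of a set of functions under almost everywhere convergent sequences that are order
bounded in `L_{Φ*}`. -/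
def SeqOrderClosed (P : Measure Ω) (Φ : ℝ → ℝ) (D : Set (Ω → ℝ)) : Prop :=
  ∀ (b : ℕ → Ω → ℝ) (x ζ : Ω → ℝ), (∀ n, b n ∈ D) → MemOrlicz P (conj Φ) ζ →
    (∀ n, ∀ᵐ ω ∂P, |b n ω| ≤ ζ ω) → Measurable x →
    (∀ᵐ ω ∂P, Tendsto (fun n => b n ω) atTop (𝓝 (x ω))) → x ∈ D

lemma IsYoung.tendsto_pairing (h : IsYoung Φ) {b : ℕ → Ω → ℝ} {x : Ω → ℝ}
    (hb : ∀ n, Measurable (b n)) (hζ : MemOrlicz P (conj Φ) ζ)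
    (hle : ∀ n, ∀ᵐ ω ∂P, |b n ω| ≤ ζ ω)
    (hlim : ∀ᵐ ω ∂P, Tendsto (fun n => b n ω) atTop (𝓝 (x ω))) (hη : MemOrlicz P Φ η) :
    Tendsto (fun n => pairing P (b n) η) atTop (𝓝 (pairing P x η)) := by
  refine tendsto_integral_of_dominated_convergence (fun ω => |ζ ω * η ω|)
    (fun n => ((hb n).mul hη.1).aestronglyMeasurable) (h.integrable_mul hζ hη).abs (fun n => ?_) ?_
  · filter_upwards [hle n] with ω hω
    rw [Real.norm_eq_abs, abs_mul, abs_mul]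
    exact mul_le_mul_of_nonneg_right (hω.trans (le_abs_self _)) (abs_nonneg _)
  · filter_upwards [hlim] with ω hω using hω.mul_const _

/-- The set of elements of `L_{Φ*}` whose pairing with every element of `S` is at most `r` in
absolute value. -/
def polarSet (P : Measure Ω) (Φ : ℝ → ℝ) (S : Set (Ω → ℝ)) (r : ℝ) : Set (Ω → ℝ) :=
  {ξ | MemOrlicz P (conj Φ) ξ ∧ ∀ η ∈ S, |pairing P ξ η| ≤ r}

lemma IsYoung.seqOrderClosed_polarSet (h : IsYoung Φ) {S : Set (Ω → ℝ)} (hS : S ⊆ Orlicz P Φ)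
    (r : ℝ) : SeqOrderClosed P Φ (polarSet P Φ S r) := by
  intro b x ζ hb hζ hle hx hlim
  refine ⟨h.isEvenConvex_conj.memOrlicz_of_abs_le hζ hx ?_, fun η hη => ?_⟩
  · filter_upwards [ae_all_iff.2 hle, hlim] with ω h1 h2
    exact le_of_tendsto h2.abs (Eventually.of_forall h1)
  · exact le_of_tendsto (h.tendsto_pairing (fun n => (hb n).1.1) hζ hle hlim (hS hη)).abs
      (Eventually.of_forall fun n => (hb n).2 η hη)

lemma SeqOrderClosed.inter {D D' : Set (Ω → ℝ)} (h : SeqOrderClosed P Φ D)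
    (h' : SeqOrderClosed P Φ D') : SeqOrderClosed P Φ (D ∩ D') :=
  fun b x ζ hb hζ hle hx hlim => ⟨h b x ζ (fun n => (hb n).1) hζ hle hx hlim,
    h' b x ζ (fun n => (hb n).2) hζ hle hx hlim⟩

lemma IsEvenConvex.memOrlicz_smul (h : IsEvenConvex f) (t : ℝ) (hg : MemOrlicz P f g) :
    MemOrlicz P f (t • g) := by
  have h1 := memOrlicz_const_mul (t := |t| + 1) (by positivity) (h.memOrlicz_abs hg)
  refine h.memOrlicz_of_abs_le h1 (hg.1.const_smul t) (Eventually.of_forall fun ω => ?_)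
  rw [Pi.smul_apply, smul_eq_mul, abs_mul]
  nlinarith [abs_nonneg (g ω)]

lemma IsYoung.pairing_add_smul (h : IsYoung Φ) {a b : ℝ} (hξ : MemOrlicz P (conj Φ) ξ)
    (hζ : MemOrlicz P (conj Φ) ζ) (hη : MemOrlicz P Φ η) :
    pairing P (a • ξ + b • ζ) η = a * pairing P ξ η + b * pairing P ζ η := by
  unfold pairing
  rw [← integral_const_mul, ← integral_const_mul, ← integral_add
    ((h.integrable_mul hξ hη).const_mul a) ((h.integrable_mul hζ hη).const_mul b)]
  refine integral_congr_ae (Eventually.of_forall fun ω => ?_)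
  simp only [Pi.add_apply, Pi.smul_apply, smul_eq_mul]
  ring

lemma IsYoung.convex_polarSet (h : IsYoung Φ) {S : Set (Ω → ℝ)} (hS : S ⊆ Orlicz P Φ)
    (r : ℝ) : Convex ℝ (polarSet P Φ S r) := by
  intro ξ hξ ζ hζ a b ha hb hab
  have hE := h.isEvenConvex_conj
  refine ⟨hE.memOrlicz_add (hE.memOrlicz_smul a hξ.1) (hE.memOrlicz_smul b hζ.1), fun η hη => ?_⟩
  rw [h.pairing_add_smul hξ.1 hζ.1 (hS hη)]
  calc |a * pairing P ξ η + b * pairing P ζ η|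
      ≤ a * |pairing P ξ η| + b * |pairing P ζ η| := by
        refine (abs_add_le _ _).trans_eq ?_
        rw [abs_mul, abs_mul, abs_of_nonneg ha, abs_of_nonneg hb]
    _ ≤ a * r + b * r := add_le_add (mul_le_mul_of_nonneg_left (hξ.2 η hη) ha)
        (mul_le_mul_of_nonneg_left (hζ.2 η hη) hb)
    _ = r := by rw [← add_mul, hab, one_mul]

end OrliczSpace

section Modular

variable {Ω : Type*} [MeasurableSpace Ω] {P : Measure Ω} {Φ : ℝ → ℝ} {η ξ : Ω → ℝ}

/-- The functions with modular at most one. -/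
def modularBall (P : Measure Ω) (Φ : ℝ → ℝ) : Set (Ω → ℝ) :=
  {η | Measurable η ∧ ∫⁻ ω, ENNReal.ofReal (Φ (η ω)) ∂P ≤ 1}

lemma modularBall_subset : modularBall P Φ ⊆ Orlicz P Φ :=
  fun _ hη => ⟨hη.1, 1, one_pos, by simpa using hη.2.trans_lt ENNReal.one_lt_top⟩

/-- A maximizer of `x ↦ x * y - Φ x` among `0` and the first `m` points of a dense sequence. -/
def conjArgmax (Φ : ℝ → ℝ) : ℕ → ℝ → ℝ
  | 0, _ => 0
  | m + 1, y =>
    if conjArgmax Φ m y * y - Φ (conjArgmax Φ m y) <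
        TopologicalSpace.denseSeq ℝ m * y - Φ (TopologicalSpace.denseSeq ℝ m)
    then TopologicalSpace.denseSeq ℝ m else conjArgmax Φ m y

lemma measurable_conjArgmax (hΦ : Measurable Φ) (m : ℕ) : Measurable (conjArgmax Φ m) := by
  induction m with
  | zero => exact measurable_const
  | succ m ih =>
    refine Measurable.ite (measurableSet_lt ((ih.mul measurable_id).sub (hΦ.comp ih))
      ((measurable_const.mul measurable_id).sub measurable_const)) measurable_const ih

lemma exists_abs_conjArgmax_le (Φ : ℝ → ℝ) (m : ℕ) : ∃ R, ∀ y, |conjArgmax Φ m y| ≤ R := by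
  induction m with
  | zero => exact ⟨0, fun y => by simp [conjArgmax]⟩
  | succ m ih =>
    obtain ⟨R, hR⟩ := ih
    refine ⟨max R |TopologicalSpace.denseSeq ℝ m|, fun y => ?_⟩
    rw [conjArgmax]
    split_ifs
    · exact le_max_right _ _
    · exact (hR y).trans (le_max_left _ _)

lemma conjArgmax_value_mono (Φ : ℝ → ℝ) (y : ℝ) :
    Monotone fun m => conjArgmax Φ m y * y - Φ (conjArgmax Φ m y) := by
  refine monotone_nat_of_le_succ fun m => ?_
  rw [conjArgmax]
  split_ifs with hif
  · exact hif.le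
  · exact le_rfl

lemma denseSeq_value_le_conjArgmax (Φ : ℝ → ℝ) (m : ℕ) (y : ℝ) :
    TopologicalSpace.denseSeq ℝ m * y - Φ (TopologicalSpace.denseSeq ℝ m) ≤
      conjArgmax Φ (m + 1) y * y - Φ (conjArgmax Φ (m + 1) y) := by
  rw [conjArgmax]
  split_ifs with hif
  · exact le_rfl
  · exact not_lt.1 hif

lemma IsYoung.ofReal_conj_eq_iSup (h : IsYoung Φ) (y : ℝ) :
    ENNReal.ofReal (conj Φ y) =
      ⨆ m, ENNReal.ofReal (conjArgmax Φ m y * y - Φ (conjArgmax Φ m y)) := by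
  refine le_antisymm ?_ (iSup_le fun m => ENNReal.ofReal_le_ofReal (h.mul_sub_le_conj _ _))
  refine le_of_forall_lt fun c hc => ?_
  by_contra hcon
  rw [not_lt] at hcon
  have hcT : c ≠ ⊤ := hc.ne_top
  have hle : ∀ m, conjArgmax Φ m y * y - Φ (conjArgmax Φ m y) ≤ c.toReal := fun m =>
    (ENNReal.ofReal_le_iff_le_toReal hcT).1 ((le_iSup (fun m => ENNReal.ofReal
      (conjArgmax Φ m y * y - Φ (conjArgmax Φ m y))) m).trans hcon)
  have : conj Φ y ≤ c.toReal := conj_le fun x => by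
    have hcl : IsClosed {x : ℝ | x * y - Φ x ≤ c.toReal} :=
      isClosed_le ((continuous_id.mul continuous_const).sub h.isEvenConvex.continuous)
        continuous_const
    have hd : closure (range (TopologicalSpace.denseSeq ℝ)) ⊆ {x : ℝ | x * y - Φ x ≤ c.toReal} :=
      closure_minimal (by
        rintro _ ⟨m, rfl⟩
        exact (denseSeq_value_le_conjArgmax Φ m y).trans (hle _)) hcl
    exact hd (TopologicalSpace.denseRange_denseSeq ℝ x)
  exact absurd (ENNReal.ofReal_le_of_le_toReal this) (not_le.2 hc)

/-- The Orlicz norm controls the modular of `L_{Φ*}`. -/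
lemma IsYoung.lintegral_conj_div_le_one [IsProbabilityMeasure P] (h : IsYoung Φ) {r : ℝ}
    (hr : 0 < r) (hξ : ξ ∈ polarSet P Φ (modularBall P Φ) r) :
    ∫⁻ ω, ENNReal.ofReal (conj Φ (ξ ω / r)) ∂P ≤ 1 := by
  have hE := h.isEvenConvex
  have hy : Measurable fun ω => ξ ω / r := hξ.1.1.div_const r
  have hmeas : ∀ m, Measurable fun ω => conjArgmax Φ m (ξ ω / r) := fun m =>
    (measurable_conjArgmax hE.continuous.measurable m).comp hy
  have hval : ∀ m, Measurable fun ω => ENNReal.ofReal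
      (conjArgmax Φ m (ξ ω / r) * (ξ ω / r) - Φ (conjArgmax Φ m (ξ ω / r))) := fun m =>
    (((hmeas m).mul hy).sub (hE.continuous.measurable.comp (hmeas m))).ennreal_ofReal
  simp_rw [h.ofReal_conj_eq_iSup]
  rw [lintegral_iSup hval
    (fun m n hmn ω => ENNReal.ofReal_le_ofReal (conjArgmax_value_mono Φ (ξ ω / r) hmn))]
  refine iSup_le fun m => ?_
  obtain ⟨R, hR⟩ := exists_abs_conjArgmax_le Φ m
  set η : Ω → ℝ := fun ω => conjArgmax Φ m (ξ ω / r) with hη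
  have hΦint : Integrable (fun ω => Φ (η ω)) P :=
    Integrable.of_bound (hE.continuous.measurable.comp (hmeas m)).aestronglyMeasurable (Φ R)
      (Eventually.of_forall fun ω => by
        rw [Real.norm_eq_abs, abs_of_nonneg (hE.nonneg _)]
        exact hE.mono_abs ((hR _).trans (le_abs_self _)))
  have hyint : Integrable (fun ω => ξ ω / r) P := (h.integrable hξ.1).div_const r
  have hprod : Integrable (fun ω => η ω * (ξ ω / r)) P :=
    hyint.bdd_mul (hmeas m).aestronglyMeasurable (Eventually.of_forall fun ω => hR _)
  set A := ∫ ω, Φ (η ω) ∂P with hA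
  have hc : 0 < max A 1 := lt_max_of_lt_right one_pos
  have hmem : (fun ω => (max A 1)⁻¹ * η ω) ∈ modularBall P Φ := by
    refine ⟨(hmeas m).const_mul _, ?_⟩
    have hle : ∀ ω, Φ ((max A 1)⁻¹ * η ω) ≤ (max A 1)⁻¹ * Φ (η ω) := fun ω =>
      hE.map_mul_le (by positivity) (inv_le_one_of_one_le₀ (le_max_right _ _)) _
    refine (lintegral_mono fun ω => ENNReal.ofReal_le_ofReal (hle ω)).trans ?_
    rw [← ofReal_integral_eq_lintegral_ofReal (hΦint.const_mul _)
      (Eventually.of_forall fun ω => mul_nonneg (by positivity) (hE.nonneg _)),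
      integral_const_mul, ← hA, ENNReal.ofReal_le_one, inv_mul_le_iff₀ hc, mul_one]
    exact le_max_left _ _
  have hpair : ∫ ω, η ω * (ξ ω / r) ∂P ≤ max A 1 := by
    have h1 := (le_abs_self _).trans (hξ.2 _ hmem)
    have h2 : pairing P ξ (fun ω => (max A 1)⁻¹ * η ω) =
        (max A 1)⁻¹ * r * ∫ ω, η ω * (ξ ω / r) ∂P := by
      rw [pairing, ← integral_const_mul]
      refine integral_congr_ae (Eventually.of_forall fun ω => ?_)
      dsimp only
      field_simp
    rw [h2, mul_assoc, inv_mul_le_iff₀ hc, mul_comm, mul_le_mul_iff_left₀ hr] at h1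
    exact h1
  have hnn : ∀ ω, 0 ≤ η ω * (ξ ω / r) - Φ (η ω) := fun ω => by
    simpa [conjArgmax, h.map_zero] using conjArgmax_value_mono Φ (ξ ω / r) (Nat.zero_le m)
  have hsub : Integrable (fun ω => η ω * (ξ ω / r) - Φ (η ω)) P := hprod.sub hΦint
  rw [← ofReal_integral_eq_lintegral_ofReal hsub (Eventually.of_forall hnn),
    ENNReal.ofReal_le_one, integral_sub hprod hΦint, ← hA]
  have hA0 : 0 ≤ A := integral_nonneg fun ω => hE.nonneg _
  rcases max_cases A 1 with ⟨h1, _⟩ | ⟨h1, _⟩ <;> rw [h1] at hpair <;> linarith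

end Modular

section CommonLimit

variable {Ω : Type*} [MeasurableSpace Ω] {P : Measure Ω}

lemma ae_summable_of_integral_le_half_pow {g : ℕ → Ω → ℝ} (hint : ∀ j, Integrable (g j) P)
    (h0 : ∀ j ω, 0 ≤ g j ω) (hle : ∀ j, ∫ ω, g j ω ∂P ≤ (1 / 2 : ℝ) ^ j) :
    ∀ᵐ ω ∂P, Summable fun j => g j ω := by
  have hfin : ∫⁻ ω, ∑' j, ENNReal.ofReal (g j ω) ∂P ≠ ⊤ := by
    rw [lintegral_tsum fun j => (hint j).aestronglyMeasurable.aemeasurable.ennreal_ofReal]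
    refine ne_top_of_le_ne_top (summable_geometric_two.tsum_ofReal_ne_top)
      (ENNReal.tsum_le_tsum fun j => ?_)
    rw [← ofReal_integral_eq_lintegral_ofReal (hint j) (Eventually.of_forall (h0 j))]
    exact ENNReal.ofReal_le_ofReal (hle j)
  filter_upwards [ae_lt_top' (AEMeasurable.tsum fun j =>
    (hint j).aestronglyMeasurable.aemeasurable.ennreal_ofReal) hfin] with ω hω
  simpa [ENNReal.toReal_ofReal (h0 _ ω)] using ENNReal.summable_toReal hω.ne

lemma integrable_min_abs_sub [IsFiniteMeasure P] {a b : Ω → ℝ} (ha : Measurable a)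
    (hb : Measurable b) : Integrable (fun ω => min |a ω - b ω| 1) P :=
  Integrable.of_bound ((ha.sub hb).abs.min measurable_const).aestronglyMeasurable 1
    (Eventually.of_forall fun ω => by
      rw [Real.norm_eq_abs, abs_of_nonneg (by positivity)]
      exact min_le_right _ _)

lemma ae_summable_abs_sub [IsFiniteMeasure P] {a b : ℕ → Ω → ℝ} (ha : ∀ j, Measurable (a j))
    (hb : ∀ j, Measurable (b j)) (hle : ∀ j, probDist P (a j) (b j) ≤ (1 / 2 : ℝ) ^ j) :
    ∀ᵐ ω ∂P, Summable fun j => |a j ω - b j ω| := by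
  filter_upwards [ae_summable_of_integral_le_half_pow
    (fun j => integrable_min_abs_sub (ha j) (hb j)) (fun j ω => by positivity) hle] with ω hω
  refine (summable_congr_atTop ?_).1 hω
  filter_upwards [hω.tendsto_atTop_zero.eventually_lt_const one_pos] with j hj
  rcases min_lt_iff.1 hj with h | h
  · exact min_eq_left h.le
  · exact absurd h (lt_irrefl _)

/-- Uniform convexity of `x ↦ √(1 + x ^ 2)` on bounded sets. -/
lemma sq_sub_le_sqrt_gap (a b : ℝ) :
    (a - b) ^ 2 ≤ (√(1 + a ^ 2) + √(1 + b ^ 2) - 2 * √(1 + ((a + b) / 2) ^ 2)) *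
      (√(1 + a ^ 2) + √(1 + b ^ 2)) ^ 3 ∧
    0 ≤ √(1 + a ^ 2) + √(1 + b ^ 2) - 2 * √(1 + ((a + b) / 2) ^ 2) := by
  have hp2 : √(1 + a ^ 2) ^ 2 = 1 + a ^ 2 := Real.sq_sqrt (by positivity)
  have hq2 : √(1 + b ^ 2) ^ 2 = 1 + b ^ 2 := Real.sq_sqrt (by positivity)
  have hw2 : √(1 + ((a + b) / 2) ^ 2) ^ 2 = 1 + ((a + b) / 2) ^ 2 := Real.sq_sqrt (by positivity)
  have hp := Real.sqrt_nonneg (1 + a ^ 2)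
  have hq := Real.sqrt_nonneg (1 + b ^ 2)
  have hw := Real.sqrt_nonneg (1 + ((a + b) / 2) ^ 2)
  generalize √(1 + a ^ 2) = p at *
  generalize √(1 + b ^ 2) = q at *
  generalize √(1 + ((a + b) / 2) ^ 2) = w at *
  have hpq : (p * q) ^ 2 - (1 + a * b) ^ 2 = (a - b) ^ 2 := by
    rw [mul_pow, hp2, hq2]; ring
  have hX : 0 ≤ p * q - (1 + a * b) := by
    refine sub_nonneg.2 (abs_le_of_sq_le_sq' ?_ (by positivity)).2
    nlinarith [sq_nonneg (a - b)]
  have hgap : (p + q) ^ 2 - (2 * w) ^ 2 = 2 * (p * q - (1 + a * b)) := by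
    rw [mul_pow, hw2]; linear_combination hp2 + hq2
  have hws : 2 * w ≤ p + q := (abs_le_of_sq_le_sq' (by linarith) (by positivity)).2
  refine ⟨?_, by linarith⟩
  have hs : 2 * (p * q + (1 + a * b)) ≤ (p + q) ^ 2 := by nlinarith [sq_nonneg (p - q)]
  have h1 : (a - b) ^ 2 ≤ (p * q - (1 + a * b)) * (p + q) ^ 2 := by
    have := mul_le_mul_of_nonneg_left hs hX
    nlinarith [sq_nonneg (a - b)]
  have h2 : (p * q - (1 + a * b)) ≤ (p + q - 2 * w) * (p + q) := by
    nlinarith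
  calc (a - b) ^ 2 ≤ (p * q - (1 + a * b)) * (p + q) ^ 2 := h1
    _ ≤ ((p + q - 2 * w) * (p + q)) * (p + q) ^ 2 :=
      mul_le_mul_of_nonneg_right h2 (by positivity)
    _ = _ := by ring

lemma min_abs_sub_le_sqrt_gap {e N : ℝ} (he : 0 < e) (hN : 0 < N) (a b : ℝ) :
    min |a - b| 1 ≤ e + (√(1 + a ^ 2) + √(1 + b ^ 2)) / N +
      N ^ 3 / e ^ 2 * (√(1 + a ^ 2) + √(1 + b ^ 2) - 2 * √(1 + ((a + b) / 2) ^ 2)) := by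
  obtain ⟨h1, h2⟩ := sq_sub_le_sqrt_gap a b
  set s := √(1 + a ^ 2) + √(1 + b ^ 2) with hs
  set g := s - 2 * √(1 + ((a + b) / 2) ^ 2)
  have hs0 : 0 ≤ s := by positivity
  have h3 : 0 ≤ s / N := by positivity
  have h4 : 0 ≤ N ^ 3 / e ^ 2 * g := by positivity
  rcases le_or_gt |a - b| e with hab | hab
  · exact (min_le_left _ _).trans (by linarith)
  refine (min_le_right _ _).trans ?_
  rcases le_or_gt N s with hNs | hNs
  · have : 1 ≤ s / N := (one_le_div hN).2 hNs
    linarith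
  · have h5 : e ^ 2 ≤ N ^ 3 * g := by
      calc e ^ 2 ≤ |a - b| ^ 2 := pow_le_pow_left₀ he.le hab.le 2
        _ = (a - b) ^ 2 := sq_abs _
        _ ≤ g * s ^ 3 := h1
        _ ≤ g * N ^ 3 := mul_le_mul_of_nonneg_left (pow_le_pow_left₀ hs0 hNs.le 3) h2
        _ = N ^ 3 * g := mul_comm _ _
    have : 1 ≤ N ^ 3 / e ^ 2 * g := by
      rw [div_mul_eq_mul_div, one_le_div (by positivity)]
      exact h5
    linarith

lemma integrable_sqrt_one_add_sq [IsFiniteMeasure P] {a : Ω → ℝ} (ha : Measurable a)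
    (hi : Integrable a P) : Integrable (fun ω => √(1 + a ω ^ 2)) P := by
  refine ((integrable_const (1 : ℝ)).add hi.abs).mono'
    ((ha.pow_const 2).const_add 1).sqrt.aestronglyMeasurable (Eventually.of_forall fun ω => ?_)
  rw [Real.norm_eq_abs, abs_of_nonneg (Real.sqrt_nonneg _)]
  refine Real.sqrt_le_iff.2 ⟨by simp only [Pi.add_apply]; positivity, ?_⟩
  simp only [Pi.add_apply]
  nlinarith [abs_nonneg (a ω), sq_abs (a ω)]

lemma exists_probDist_le_of_near_min [IsProbabilityMeasure P] {s ε : ℝ} (hs : 0 ≤ s)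
    (hε : 0 < ε) : ∃ δ > 0, ∀ a b : Ω → ℝ, Measurable a → Integrable a P → Measurable b →
      Integrable b P → ∫ ω, √(1 + a ω ^ 2) ∂P ≤ s + δ → ∫ ω, √(1 + b ω ^ 2) ∂P ≤ s + δ →
      s - δ ≤ ∫ ω, √(1 + ((a ω + b ω) / 2) ^ 2) ∂P → probDist P a b ≤ ε := by
  set e := ε / 3 with he
  have he0 : 0 < e := by positivity
  set N := 2 * (s + 1) / e with hN
  have hN0 : 0 < N := by positivity
  refine ⟨min 1 (e ^ 3 / (4 * N ^ 3)), by positivity, fun a b ha hai hb hbi h1 h2 h3 => ?_⟩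
  set δ := min 1 (e ^ 3 / (4 * N ^ 3)) with hδ
  have hδ1 : δ ≤ 1 := min_le_left _ _
  have hδ2 : N ^ 3 / e ^ 2 * (4 * δ) ≤ e := by
    have : δ ≤ e ^ 3 / (4 * N ^ 3) := min_le_right _ _
    rw [le_div_iff₀ (by positivity)] at this
    rw [div_mul_eq_mul_div, div_le_iff₀ (by positivity)]
    linarith
  have ia := integrable_sqrt_one_add_sq ha hai
  have ib := integrable_sqrt_one_add_sq hb hbi
  have im := integrable_sqrt_one_add_sq ((ha.add hb).div_const 2) ((hai.add hbi).div_const 2)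
  simp only [Pi.add_apply] at im
  have iab : Integrable (fun ω => √(1 + a ω ^ 2) + √(1 + b ω ^ 2)) P := ia.add ib
  have ie : Integrable (fun ω => e + (√(1 + a ω ^ 2) + √(1 + b ω ^ 2)) / N) P :=
    (integrable_const e).add (iab.div_const N)
  have ig : Integrable (fun ω => N ^ 3 / e ^ 2 * (√(1 + a ω ^ 2) + √(1 + b ω ^ 2) -
      2 * √(1 + ((a ω + b ω) / 2) ^ 2))) P :=
    (iab.sub (im.const_mul 2)).const_mul (N ^ 3 / e ^ 2)
  have hle := integral_mono (integrable_min_abs_sub ha hb)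
    (ie.add ig)
    (fun ω => min_abs_sub_le_sqrt_gap he0 hN0 (a ω) (b ω))
  have heq : ∫ ω, (e + (√(1 + a ω ^ 2) + √(1 + b ω ^ 2)) / N +
      N ^ 3 / e ^ 2 * (√(1 + a ω ^ 2) + √(1 + b ω ^ 2) -
        2 * √(1 + ((a ω + b ω) / 2) ^ 2))) ∂P =
      e + (∫ ω, √(1 + a ω ^ 2) ∂P + ∫ ω, √(1 + b ω ^ 2) ∂P) / N + N ^ 3 / e ^ 2 *
        (∫ ω, √(1 + a ω ^ 2) ∂P + ∫ ω, √(1 + b ω ^ 2) ∂P -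
          2 * ∫ ω, √(1 + ((a ω + b ω) / 2) ^ 2) ∂P) := by
    rw [integral_add ie ig,
      integral_add (integrable_const e) (iab.div_const N), integral_const_mul,
      integral_sub iab (im.const_mul 2), integral_const_mul, integral_div N, integral_add ia ib]
    simp only [integral_const, probReal_univ, one_smul]
  refine hle.trans (heq.trans_le ?_)
  have h4 : (∫ ω, √(1 + a ω ^ 2) ∂P + ∫ ω, √(1 + b ω ^ 2) ∂P) / N ≤ e := by
    rw [div_le_iff₀ hN0, hN, mul_div_cancel₀ _ he0.ne']
    linarith
  have h5 : N ^ 3 / e ^ 2 * (∫ ω, √(1 + a ω ^ 2) ∂P + ∫ ω, √(1 + b ω ^ 2) ∂P -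
          2 * ∫ ω, √(1 + ((a ω + b ω) / 2) ^ 2) ∂P) ≤ e :=
    le_trans (mul_le_mul_of_nonneg_left (by linarith) (by positivity)) hδ2
  linarith

/-- A directed family of nonempty convex sets of functions, bounded in `L¹`, has a common
almost everywhere limit point. -/
lemma exists_common_limit [IsProbabilityMeasure P] {ι : Type*} [DecidableEq ι]
    (D : Finset ι → Set (Ω → ℝ)) (hanti : ∀ F F', F ⊆ F' → D F' ⊆ D F)
    (hne : ∀ F, (D F).Nonempty) (hconv : ∀ F, Convex ℝ (D F))
    (hmeas : ∀ ξ ∈ D ∅, Measurable ξ) (hint : ∀ ξ ∈ D ∅, Integrable ξ P) {R : ℝ}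
    (hR : ∀ ξ ∈ D ∅, ∫ ω, |ξ ω| ∂P ≤ R) :
    ∃ x : Ω → ℝ, Measurable x ∧ ∀ F, ∃ b : ℕ → Ω → ℝ, (∀ j, b j ∈ D F) ∧
      ∀ᵐ ω ∂P, Tendsto (fun j => b j ω) atTop (𝓝 (x ω)) := by
  set J : (Ω → ℝ) → ℝ := fun ξ => ∫ ω, √(1 + ξ ω ^ 2) ∂P with hJ
  have h0 : ∀ F, D F ⊆ D ∅ := fun F => hanti _ _ (Finset.empty_subset F)
  have hJ0 : ∀ ξ, 0 ≤ J ξ := fun ξ => integral_nonneg fun ω => Real.sqrt_nonneg _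
  have hJR : ∀ ξ ∈ D ∅, J ξ ≤ 1 + R := fun ξ hξ => by
    have h1 : J ξ ≤ ∫ ω, (1 + |ξ ω|) ∂P := integral_mono
      (integrable_sqrt_one_add_sq (hmeas ξ hξ) (hint ξ hξ))
      ((integrable_const (1 : ℝ)).add (hint ξ hξ).abs) fun ω => by
        refine Real.sqrt_le_iff.2 ⟨by positivity, ?_⟩
        nlinarith [abs_nonneg (ξ ω), sq_abs (ξ ω)]
    rw [integral_add (integrable_const _) (hint ξ hξ).abs] at h1
    simp only [integral_const, probReal_univ, one_smul] at h1
    linarith [hR ξ hξ]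
  set m : Finset ι → ℝ := fun F => sInf (J '' D F) with hm
  have hbdd : ∀ F, BddBelow (J '' D F) := fun F => ⟨0, by
    rintro _ ⟨ξ, -, rfl⟩; exact hJ0 ξ⟩
  have hmle : ∀ F, ∀ ξ ∈ D F, m F ≤ J ξ := fun F ξ hξ => csInf_le (hbdd F) ⟨ξ, hξ, rfl⟩
  have hmbdd : BddAbove (range m) := ⟨1 + R, by
    rintro _ ⟨F, rfl⟩
    obtain ⟨ξ, hξ⟩ := hne F
    exact (hmle F ξ hξ).trans (hJR ξ (h0 F hξ))⟩
  set s := ⨆ F, m F with hs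
  have hs0 : 0 ≤ s := le_trans (le_csInf ((hne ∅).image J) (by
    rintro _ ⟨ξ, -, rfl⟩; exact hJ0 ξ)) (le_ciSup hmbdd ∅)
  have hnear : ∀ F, ∀ t > 0, ∃ ξ ∈ D F, J ξ ≤ s + t := fun F t ht => by
    obtain ⟨_, ⟨ξ, hξ, rfl⟩, hlt⟩ := exists_lt_of_csInf_lt ((hne F).image J)
      (lt_of_le_of_lt (le_ciSup hmbdd F) (lt_add_of_pos_right s ht))
    exact ⟨ξ, hξ, hlt.le⟩
  choose δ hδ hclose using fun j : ℕ => exists_probDist_le_of_near_min (P := P) hs0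
    (by positivity : (0 : ℝ) < (1 / 2) ^ j)
  have hG : ∀ j, ∃ F, s - δ j < m F := fun j =>
    exists_lt_of_lt_ciSup (sub_lt_self s (hδ j))
  choose G hG using hG
  have hdist : ∀ j, ∀ a ∈ D (G j), ∀ b ∈ D (G j), J a ≤ s + δ j → J b ≤ s + δ j →
      probDist P a b ≤ (1 / 2) ^ j := fun j a ha b hb hJa hJb => by
    refine hclose j a b (hmeas a (h0 _ ha)) (hint a (h0 _ ha)) (hmeas b (h0 _ hb))
      (hint b (h0 _ hb)) hJa hJb ?_
    have hmid := (hconv (G j)) ha hb (by norm_num : (0 : ℝ) ≤ 1 / 2)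
      (by norm_num : (0 : ℝ) ≤ 1 / 2) (by norm_num)
    have h2 : J ((1 / 2 : ℝ) • a + (1 / 2 : ℝ) • b) =
        ∫ ω, √(1 + ((a ω + b ω) / 2) ^ 2) ∂P := by
      refine integral_congr_ae (Eventually.of_forall fun ω => ?_)
      simp only [Pi.add_apply, Pi.smul_apply, smul_eq_mul]
      ring_nf
    rw [← h2]
    exact (hG j).le.trans (hmle _ _ hmid)
  choose a ha hJa using fun j : ℕ => hnear (G j ∪ G (j - 1)) (min (δ j) (δ (j - 1)))
    (lt_min (hδ _) (hδ _))
  have ha' : ∀ j, a j ∈ D (G j) := fun j => hanti _ _ Finset.subset_union_left (ha j)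
  have hJa' : ∀ j, J (a j) ≤ s + δ j := fun j =>
    (hJa j).trans (add_le_add_right (min_le_left _ _) _)
  have ham : ∀ j, Measurable (a j) := fun j => hmeas _ (h0 _ (ha j))
  have hsucc : ∀ j, probDist P (a j) (a (j + 1)) ≤ (1 / 2) ^ j := fun j =>
    hdist j _ (ha' j) _ (hanti _ _ Finset.subset_union_right (ha (j + 1))) (hJa' j)
      ((hJa (j + 1)).trans (add_le_add_right (min_le_right _ _) _))
  have hlim : ∀ᵐ ω ∂P, ∃ l, Tendsto (fun j => a j ω) atTop (𝓝 l) := by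
    filter_upwards [ae_summable_abs_sub ham (fun j => ham (j + 1)) hsucc] with ω hω
    exact cauchySeq_tendsto_of_complete (cauchySeq_of_summable_dist hω)
  obtain ⟨x, hx, hax⟩ := measurable_limit_of_tendsto_metrizable_ae
    (fun j => (ham j).aemeasurable) hlim
  refine ⟨x, hx, fun F => ?_⟩
  choose b hb hJb using fun j : ℕ => hnear (G j ∪ F) (δ j) (hδ j)
  refine ⟨b, fun j => hanti _ _ Finset.subset_union_right (hb j), ?_⟩
  have hbm : ∀ j, Measurable (b j) := fun j => hmeas _ (h0 _ (hb j))
  filter_upwards [hax, ae_summable_abs_sub hbm ham fun j => hdist j _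
    (hanti _ _ Finset.subset_union_left (hb j)) _ (ha' j) (hJb j) (hJa' j)] with ω h1 h2
  have h3 := (tendsto_zero_iff_abs_tendsto_zero _).2 h2.tendsto_atTop_zero
  simpa using h3.add h1

end CommonLimit

section OrderBounded

variable {Ω : Type*} [MeasurableSpace Ω] {P : Measure Ω} {Φ : ℝ → ℝ}

/-- Functions whose images under `Φ*` have a common integrable bound are order bounded. -/
lemma IsYoung.exists_dominating (h : IsYoung Φ) {g : ℕ → Ω → ℝ} (hg : ∀ k, Measurable (g k))
    {l : ℝ} (hl : 0 < l) {T : Ω → ℝ≥0∞} (hTm : AEMeasurable T P) (hT : ∫⁻ ω, T ω ∂P ≠ ⊤)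
    (hle : ∀ k, ∀ᵐ ω ∂P, ENNReal.ofReal (conj Φ (l * g k ω)) ≤ T ω) :
    ∃ ζ, MemOrlicz P (conj Φ) ζ ∧ ∀ k, ∀ᵐ ω ∂P, |g k ω| ≤ ζ ω := by
  set S : Ω → ℝ≥0∞ := fun ω => ⨆ k, ENNReal.ofReal |g k ω| with hS
  have hSm : Measurable S := Measurable.iSup fun k => (hg k).abs.ennreal_ofReal
  have hae : ∀ᵐ ω ∂P, T ω ≠ ⊤ ∧ ∀ k, conj Φ (l * g k ω) ≤ (T ω).toReal := by
    filter_upwards [ae_lt_top' hTm hT, ae_all_iff.2 hle] with ω h1 h2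
    exact ⟨h1.ne, fun k => (ENNReal.ofReal_le_iff_le_toReal h1.ne).1 (h2 k)⟩
  have hbound : ∀ ω, (∀ k, conj Φ (l * g k ω) ≤ (T ω).toReal) → ∀ x, x ≠ 0 →
      S ω ≤ ENNReal.ofReal (((T ω).toReal + Φ x) / (|x| * l)) := fun ω hω x hx => by
    refine iSup_le fun k => ENNReal.ofReal_le_ofReal ?_
    have h1 := h.abs_mul_le x (l * g k ω)
    have h2 : 0 < |x| := abs_pos.2 hx
    rw [abs_mul, abs_mul, abs_of_pos hl] at h1
    rw [le_div_iff₀ (by positivity)]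
    linarith [hω k]
  refine ⟨fun ω => (S ω).toReal, ⟨hSm.ennreal_toReal, l, hl, ?_⟩, fun k => ?_⟩
  · refine lt_of_le_of_lt (lintegral_mono_ae ?_) hT.lt_top
    filter_upwards [hae] with ω hω
    refine (ENNReal.ofReal_le_iff_le_toReal hω.1).2 (conj_le fun x => ?_)
    have hx0 := h.isEvenConvex.nonneg x
    rcases eq_or_ne x 0 with rfl | hx
    · simp [h.map_zero]
    have h2 : 0 < |x| := abs_pos.2 hx
    have h3 : (S ω).toReal ≤ ((T ω).toReal + Φ x) / (|x| * l) :=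
      ENNReal.toReal_le_of_le_ofReal (by positivity) (hbound ω hω.2 x hx)
    rw [le_div_iff₀ (by positivity)] at h3
    have h4 : x * (l * (S ω).toReal) ≤ |x| * (l * (S ω).toReal) :=
      mul_le_mul_of_nonneg_right (le_abs_self x) (by positivity)
    linarith
  · filter_upwards [hae] with ω hω
    have h1 : S ω ≠ ⊤ := ne_top_of_le_ne_top ENNReal.ofReal_ne_top (hbound ω hω.2 1 one_ne_zero)
    exact (ENNReal.ofReal_le_iff_le_toReal h1).1 (le_iSup (fun k => ENNReal.ofReal |g k ω|) k)

/-- A bound for an average in which all the large terms, except possibly the last one, are under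
control. -/
lemma IsEvenConvex.map_average_le {f : ℝ → ℝ} (h : IsEvenConvex f) {s : Finset ℕ} {N : ℝ}
    (hN : 0 < N) (hcard : (s.card : ℝ) ≤ N) {β : ℕ → ℝ} (hβ : ∀ i, 0 ≤ β i) {A B : ℝ}
    (hA1 : f 1 ≤ A) (hB0 : 0 ≤ B)
    (hA : ∀ i ∈ s, ∀ i' ∈ s, i < i' → 1 < β i' → f (β i) ≤ A)
    (hB : ∀ i ∈ s, 1 < β i → f (β i / N) ≤ B) :
    f ((∑ i ∈ s, β i) / N / 2) ≤ A + B := by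
  have hA0 : 0 ≤ A := (h.nonneg 1).trans hA1
  have key : ∀ t ⊆ s, (∀ i ∈ t, 1 < β i → f (β i) ≤ A) → f ((∑ i ∈ t, β i) / N) ≤ A := by
    intro t hts ht
    rcases t.eq_empty_or_nonempty with rfl | hne
    · simpa [h.map_zero] using hA0
    obtain ⟨j, hj, hmax⟩ := t.exists_max_image β hne
    have h1 : (∑ i ∈ t, β i) / N ≤ max 1 (β j) := by
      rw [div_le_iff₀ hN]
      have h2 : ∑ i ∈ t, β i ≤ t.card • max 1 (β j) :=
        Finset.sum_le_card_nsmul _ _ _ fun i hi => (hmax i hi).trans (le_max_right _ _)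
      rw [nsmul_eq_mul, mul_comm] at h2
      refine h2.trans (mul_le_mul_of_nonneg_left ?_ (by positivity))
      exact le_trans (by exact_mod_cast Finset.card_le_card hts) hcard
    have h0 : 0 ≤ (∑ i ∈ t, β i) / N := div_nonneg (Finset.sum_nonneg fun i _ => hβ i) hN.le
    refine (h.mono_abs (y := max 1 (β j)) ?_).trans ?_
    · rwa [abs_of_nonneg h0, abs_of_nonneg (h0.trans h1)]
    · rcases le_or_gt (β j) 1 with hj1 | hj1
      · rwa [max_eq_left hj1]
      · rw [max_eq_right hj1.le]
        exact ht j hj hj1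
  have hX0 := h.nonneg
  by_cases hlarge : ∃ i ∈ s, 1 < β i
  · obtain ⟨i, hi, hi1⟩ := hlarge
    obtain ⟨i₀, hi₀, hmax⟩ := (s.filter fun i => 1 < β i).exists_max_image id
      ⟨i, Finset.mem_filter.2 ⟨hi, hi1⟩⟩
    rw [Finset.mem_filter] at hi₀
    have hX := key (s.erase i₀) (Finset.erase_subset _ _) fun i hi hi1 => by
      have hne := Finset.ne_of_mem_erase hi
      have his := Finset.mem_of_mem_erase hi
      exact hA i his i₀ hi₀.1
        (lt_of_le_of_ne (hmax i (Finset.mem_filter.2 ⟨his, hi1⟩)) hne) hi₀.2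
    have hY := hB i₀ hi₀.1 hi₀.2
    rw [← Finset.sum_erase_add s β hi₀.1, add_div]
    have := h.map_midpoint_le ((∑ i ∈ s.erase i₀, β i) / N) (β i₀ / N)
    linarith
  · push Not at hlarge
    have hX := key s subset_rfl fun i hi hi1 => absurd hi1 (not_lt.2 (hlarge i hi))
    have := h.map_midpoint_le ((∑ i ∈ s, β i) / N) 0
    rw [add_zero, h.map_zero] at this
    linarith

end OrderBounded

section KeyLemma

variable {Ω : Type*} [MeasurableSpace Ω] {P : Measure Ω} {Φ : ℝ → ℝ}

lemma exists_sparse_subsequence {v : ℕ → Ω → ℝ≥0∞} (hv : ∀ n, ∫⁻ ω, v n ω ∂P ≠ ⊤)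
    {A : ℕ → Set Ω} (hA : Tendsto (fun n => P (A n)) atTop (𝓝 0)) {c : ℕ → ℝ≥0∞}
    (hc : ∀ k, 0 < c k) (hanti : Antitone c) :
    ∃ n : ℕ → ℕ, StrictMono n ∧ (∀ k, P (A (n k)) ≤ c k) ∧
      ∀ i j, i < j → ∫⁻ ω in A (n j), v (n i) ω ∂P ≤ 2⁻¹ ^ i * 2⁻¹ ^ j := by
  obtain ⟨F, hF, hr⟩ := exists_seq_of_forall_finset_exists
    (fun p : ℕ × ℕ => P (A p.2) ≤ c p.1)
    (fun p q => p.1 < q.1 ∧ p.2 < q.2 ∧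
      ∫⁻ ω in A q.2, v p.2 ω ∂P ≤ 2⁻¹ ^ p.1 * 2⁻¹ ^ q.1) fun s _ => by
    set N := s.sup Prod.fst + 1
    have hpos : ∀ i, (0 : ℝ≥0∞) < 2⁻¹ ^ i * 2⁻¹ ^ N := fun i =>
      ENNReal.mul_pos (pow_ne_zero _ (by simp)) (pow_ne_zero _ (by simp))
    have hev : ∀ᶠ n in atTop, P (A n) ≤ c N ∧ ∀ p ∈ s, p.2 < n ∧
        ∫⁻ ω in A n, v p.2 ω ∂P ≤ 2⁻¹ ^ p.1 * 2⁻¹ ^ N := by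
      refine ((tendsto_order.1 hA).2 _ (hc N)).and (s.eventually_all.2 fun p _ => ?_) |>.mono
        fun n hn => ⟨hn.1.le, hn.2⟩
      exact (eventually_gt_atTop p.2).and (((tendsto_order.1
        (tendsto_setLIntegral_zero (hv p.2) hA)).2 _ (hpos p.1)).mono fun n hn => hn.le)
    obtain ⟨n, hn, hns⟩ := hev.exists
    exact ⟨(N, n), hn, fun p hp =>
      ⟨Nat.lt_succ_of_le (Finset.le_sup (f := Prod.fst) hp), (hns p hp).1, (hns p hp).2⟩⟩
  have hmono : StrictMono fun k => (F k).1 := fun i j hij => (hr i j hij).1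
  have hle : ∀ k, k ≤ (F k).1 := fun k => hmono.le_apply
  refine ⟨fun k => (F k).2, fun i j hij => (hr i j hij).2.1,
    fun k => (hF k).trans (hanti (hle k)), fun i j hij => (hr i j hij).2.2.trans ?_⟩
  exact mul_le_mul' (pow_le_pow_right_of_le_one' (by simp) (hle i))
    (pow_le_pow_right_of_le_one' (by simp) (hle j))

lemma IsEvenConvex.exists_bound_average {f : ℝ → ℝ} (h : IsEvenConvex f) [IsFiniteMeasure P]
    {M : ℕ} (hM : 1 ≤ M) {d : ℝ} (hd : 0 ≤ d)
    (hpow : ∀ (k : ℕ) (u : ℝ), f (u / M ^ k) ≤ f u / (2 * M) ^ k + d) {β : ℕ → Ω → ℝ}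
    (hβm : ∀ i, Measurable (β i)) (hβ : ∀ i ω, 0 ≤ β i ω)
    (hmod : ∀ i, ∫⁻ ω, ENNReal.ofReal (f (β i ω)) ∂P ≤ 2)
    (hmeas : ∀ i, P {ω | 1 < β i ω} ≤ ENNReal.ofReal (1 / (2 * M) ^ i))
    (hcross : ∀ i j, i < j →
      ∫⁻ ω in {ω | 1 < β j ω}, ENNReal.ofReal (f (β i ω)) ∂P ≤ 2⁻¹ ^ i * 2⁻¹ ^ j) :
    ∃ T : Ω → ℝ≥0∞, Measurable T ∧ ∫⁻ ω, T ω ∂P ≠ ⊤ ∧ ∀ k, ∀ᵐ ω ∂P, ENNReal.ofReal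
      (f ((∑ i ∈ Finset.Ico k (k + M ^ k), β i ω) / (M : ℝ) ^ k / 2)) ≤ T ω := by
  have hM0 : (0 : ℝ) < M := by exact_mod_cast hM
  have hAm : ∀ i, MeasurableSet {ω | 1 < β i ω} := fun i => measurableSet_lt measurable_const (hβm i)
  set G : ℕ × ℕ → Ω → ℝ≥0∞ := fun p => if p.1 < p.2 then
    {ω | 1 < β p.2 ω}.indicator (fun ω => ENNReal.ofReal (f (β p.1 ω))) else 0 with hG
  set H : ℕ → ℕ → Ω → ℝ≥0∞ := fun k i =>
    {ω | 1 < β i ω}.indicator (fun ω => ENNReal.ofReal (f (β i ω / (M : ℝ) ^ k))) with hH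
  have hGm : ∀ p, Measurable (G p) := fun p => by
    simp only [hG]
    split_ifs
    · exact (h.measurable_ofReal_comp (hβm _)).indicator (hAm _)
    · exact measurable_zero
  have hHm : ∀ k i, Measurable (H k i) := fun k i =>
    (h.measurable_ofReal_comp ((hβm i).div_const _)).indicator (hAm i)
  have hHsm : ∀ k, Measurable fun ω => ∑ i ∈ Finset.Ico k (k + M ^ k), H k i ω := fun k =>
    Finset.measurable_sum _ fun i _ => hHm k i
  set T₁ : Ω → ℝ≥0∞ := fun ω => ∑' p, G p ω
  set T₂ : Ω → ℝ≥0∞ := fun ω => ∑' k, ∑ i ∈ Finset.Ico k (k + M ^ k), H k i ω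
  have hT₁m : Measurable T₁ := Measurable.tsum hGm
  have hT₂m : Measurable T₂ := Measurable.tsum hHsm
  have hT₁ : ∫⁻ ω, T₁ ω ∂P ≠ ⊤ := by
    rw [lintegral_tsum fun p => (hGm p).aemeasurable]
    have hle : ∀ p : ℕ × ℕ, ∫⁻ ω, G p ω ∂P ≤ 2⁻¹ ^ p.1 * 2⁻¹ ^ p.2 := fun p => by
      simp only [hG]
      split_ifs with hp
      · rw [lintegral_indicator (hAm _)]
        exact hcross _ _ hp
      · simp
    refine ne_top_of_le_ne_top ?_ (ENNReal.tsum_le_tsum hle)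
    rw [ENNReal.tsum_prod (f := fun i j : ℕ => (2⁻¹ : ℝ≥0∞) ^ i * 2⁻¹ ^ j)]
    simp_rw [ENNReal.tsum_mul_left, ENNReal.tsum_mul_right, ENNReal.tsum_geometric,
      ENNReal.one_sub_inv_two, inv_inv]
    finiteness
  have hT₂ : ∫⁻ ω, T₂ ω ∂P ≠ ⊤ := by
    rw [lintegral_tsum fun k => (hHsm k).aemeasurable]
    have hterm : ∀ k, ∀ i ∈ Finset.Ico k (k + M ^ k),
        ∫⁻ ω, H k i ω ∂P ≤ ENNReal.ofReal ((2 + d) * (1 / (2 * M) ^ k)) := fun k i hi => by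
      have hki : k ≤ i := (Finset.mem_Ico.1 hi).1
      simp only [hH]
      rw [lintegral_indicator (hAm i)]
      calc ∫⁻ ω in {ω | 1 < β i ω}, ENNReal.ofReal (f (β i ω / (M : ℝ) ^ k)) ∂P
          ≤ ∫⁻ ω in {ω | 1 < β i ω}, (ENNReal.ofReal (1 / (2 * M) ^ k) *
              ENNReal.ofReal (f (β i ω)) + ENNReal.ofReal d) ∂P := by
            refine lintegral_mono fun ω => ?_
            rw [← ENNReal.ofReal_mul (by positivity), ← ENNReal.ofReal_add
              (mul_nonneg (by positivity) (h.nonneg _)) hd]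
            refine ENNReal.ofReal_le_ofReal ((hpow k _).trans_eq ?_)
            rw [one_div, inv_mul_eq_div]
        _ = ENNReal.ofReal (1 / (2 * M) ^ k) *
              ∫⁻ ω in {ω | 1 < β i ω}, ENNReal.ofReal (f (β i ω)) ∂P +
              ENNReal.ofReal d * P {ω | 1 < β i ω} := by
            rw [lintegral_add_right _ measurable_const,
              lintegral_const_mul _ (h.measurable_ofReal_comp (hβm i)), setLIntegral_const]
        _ ≤ ENNReal.ofReal (1 / (2 * M) ^ k) * 2 +
              ENNReal.ofReal d * ENNReal.ofReal (1 / (2 * M) ^ k) := by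
            refine add_le_add (mul_le_mul_right ((setLIntegral_le_lintegral _ _).trans (hmod i)) _)
              (mul_le_mul_right ((hmeas i).trans (ENNReal.ofReal_le_ofReal ?_)) _)
            have h1 : (1 : ℝ) ≤ 2 * M := by
              have : (1 : ℝ) ≤ M := by exact_mod_cast hM
              linarith
            exact one_div_le_one_div_of_le (by positivity) (pow_le_pow_right₀ h1 hki)
        _ = _ := by
            rw [← ENNReal.ofReal_ofNat 2, ← ENNReal.ofReal_mul (by positivity),
              ← ENNReal.ofReal_mul hd, ← ENNReal.ofReal_add (by positivity) (by positivity)]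
            congr 1
            ring
    have hle : ∀ k, ∫⁻ ω, ∑ i ∈ Finset.Ico k (k + M ^ k), H k i ω ∂P ≤
        ENNReal.ofReal ((2 + d) * (1 / 2) ^ k) := fun k => by
      rw [lintegral_finsetSum _ fun i _ => hHm k i]
      refine (Finset.sum_le_card_nsmul _ _ _ (hterm k)).trans_eq ?_
      rw [Nat.card_Ico, Nat.add_sub_cancel_left, nsmul_eq_mul, ← ENNReal.ofReal_natCast,
        ← ENNReal.ofReal_mul (by positivity)]
      congr 1
      push_cast
      rw [mul_pow, div_pow, one_pow]
      field_simp
    refine ne_top_of_le_ne_top ?_ (ENNReal.tsum_le_tsum hle)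
    exact (summable_geometric_two.mul_left _).tsum_ofReal_ne_top
  refine ⟨fun ω => (ENNReal.ofReal (f 1) + T₁ ω) + T₂ ω, by fun_prop, ?_, fun k => ?_⟩
  · rw [lintegral_add_right _ hT₂m, lintegral_add_right _ hT₁m, lintegral_const]
    finiteness
  filter_upwards [ae_lt_top hT₁m hT₁, ae_lt_top hT₂m hT₂] with ω h1 h2
  have hG1 : ∀ p, G p ω ≤ T₁ ω := fun p => ENNReal.le_tsum p
  have hH1 : ∀ i ∈ Finset.Ico k (k + M ^ k), H k i ω ≤ T₂ ω := fun i hi =>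
    (Finset.single_le_sum (f := fun i => H k i ω) (fun _ _ => zero_le) hi).trans
      (ENNReal.le_tsum (f := fun k => ∑ i ∈ Finset.Ico k (k + M ^ k), H k i ω) k)
  have := h.map_average_le (s := Finset.Ico k (k + M ^ k)) (N := (M : ℝ) ^ k) (by positivity)
    (by simp) (β := fun i => β i ω) (fun i => hβ i ω) (A := f 1 + (T₁ ω).toReal)
    (B := (T₂ ω).toReal) (by simp) ENNReal.toReal_nonneg (fun i hi j hj hij hj1 => by
      have h3 := hG1 (i, j)
      simp only [hG, if_pos hij] at h3
      rw [indicator_of_mem (show ω ∈ {ω | 1 < β j ω} from hj1),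
        ENNReal.ofReal_le_iff_le_toReal h1.ne] at h3
      linarith [h.nonneg 1]) (fun i hi hi1 => by
      have h3 := hH1 i hi
      simp only [hH] at h3
      rwa [indicator_of_mem (show ω ∈ {ω | 1 < β i ω} from hi1),
        ENNReal.ofReal_le_iff_le_toReal h2.ne] at h3)
  refine (ENNReal.ofReal_le_ofReal this).trans_eq ?_
  rw [ENNReal.ofReal_add (add_nonneg (h.nonneg _) ENNReal.toReal_nonneg) ENNReal.toReal_nonneg,
    ENNReal.ofReal_add (h.nonneg _) ENNReal.toReal_nonneg, ENNReal.ofReal_toReal h1.ne,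
    ENNReal.ofReal_toReal h2.ne]

/-- Block averages of a sparse enough subsequence of a modular bounded, almost everywhere convergent
sequence are order bounded. Hence order closed convex sets contain such limits. -/
lemma IsYoung.mem_of_ae_tendsto [IsProbabilityMeasure P] (h : IsYoung Φ) (hΔ : Delta2 Φ)
    {D : Set (Ω → ℝ)} (hD : SeqOrderClosed P Φ D) (hconv : Convex ℝ D) {b : ℕ → Ω → ℝ}
    {x : Ω → ℝ} (hb : ∀ n, b n ∈ D) (hbm : ∀ n, Measurable (b n)) {l : ℝ} (hl : 0 < l)
    (hmod : ∀ n, ∫⁻ ω, ENNReal.ofReal (conj Φ (l * b n ω)) ∂P ≤ 1) (hx : Measurable x)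
    (hlim : ∀ᵐ ω ∂P, Tendsto (fun n => b n ω) atTop (𝓝 (x ω))) : x ∈ D := by
  have hE := h.isEvenConvex_conj
  have hxmod : ∫⁻ ω, ENNReal.ofReal (conj Φ (l * x ω)) ∂P ≤ 1 := by
    calc ∫⁻ ω, ENNReal.ofReal (conj Φ (l * x ω)) ∂P
        = ∫⁻ ω, liminf (fun n => ENNReal.ofReal (conj Φ (l * b n ω))) atTop ∂P := by
          refine lintegral_congr_ae ?_
          filter_upwards [hlim] with ω hω
          exact (((ENNReal.continuous_ofReal.comp hE.continuous).tendsto _).comp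
            (hω.const_mul l)).liminf_eq.symm
      _ ≤ liminf (fun n => ∫⁻ ω, ENNReal.ofReal (conj Φ (l * b n ω)) ∂P) atTop :=
          lintegral_liminf_le fun n => hE.measurable_ofReal_comp ((hbm n).const_mul l)
      _ ≤ 1 := by
          refine liminf_le_of_le (by isBoundedDefault) fun c hc => ?_
          obtain ⟨n, hn⟩ := hc.exists
          exact hn.trans (hmod n)
  set u : ℕ → Ω → ℝ := fun n ω => |l * (b n ω - x ω) / 2| with hu
  have hum : ∀ n, Measurable (u n) := fun n => ((((hbm n).sub hx).const_mul l).div_const 2).abs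
  have humod : ∀ n, ∫⁻ ω, ENNReal.ofReal (conj Φ (u n ω)) ∂P ≤ 2 := fun n => by
    calc ∫⁻ ω, ENNReal.ofReal (conj Φ (u n ω)) ∂P
        ≤ ∫⁻ ω, (ENNReal.ofReal (conj Φ (l * b n ω)) + ENNReal.ofReal (conj Φ (l * x ω))) ∂P := by
          refine lintegral_mono fun ω => ?_
          rw [← ENNReal.ofReal_add (hE.nonneg _) (hE.nonneg _)]
          refine ENNReal.ofReal_le_ofReal ?_
          have h1 := hE.map_midpoint_le (l * b n ω) (-(l * x ω))
          rw [hE.even] at h1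
          have h2 := hE.nonneg (l * b n ω)
          have h3 := hE.nonneg (l * x ω)
          rw [hu]
          simp only
          rw [hE.map_abs, show l * (b n ω - x ω) / 2 = (l * b n ω + -(l * x ω)) / 2 by ring]
          linarith
      _ ≤ 1 + 1 := by
          rw [lintegral_add_left (hE.measurable_ofReal_comp ((hbm n).const_mul l))]
          exact add_le_add (hmod n) hxmod
      _ = 2 := one_add_one_eq_two
  have hAlim : Tendsto (fun n => P {ω | 1 < u n ω}) atTop (𝓝 0) := by
    have h1 := tendstoInMeasure_of_tendsto_ae (fun n => (hum n).aestronglyMeasurable)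
      (g := fun _ => (0 : ℝ)) (μ := P) (by
        filter_upwards [hlim] with ω hω
        have : Tendsto (fun n => |l * (b n ω - x ω) / 2|) atTop
            (𝓝 |l * (x ω - x ω) / 2|) := (((hω.sub_const _).const_mul l).div_const 2).abs
        simpa using this)
    have h2 := (tendstoInMeasure_iff_dist.1 h1) 1 one_pos
    refine tendsto_of_tendsto_of_tendsto_of_le_of_le tendsto_const_nhds h2 (fun _ => zero_le)
      fun n => measure_mono fun ω hω => ?_
    simp only [mem_ofPred_eq, Real.dist_eq, sub_zero] at hω ⊢
    exact hω.le.trans (le_abs_self _)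
  obtain ⟨M, hM, d, hd, hpow⟩ := h.exists_conj_div_pow_le hΔ
  have hM1 : (1 : ℝ) ≤ M := by exact_mod_cast hM
  obtain ⟨n, hn, hnA, hncross⟩ := exists_sparse_subsequence (P := P)
    (v := fun n ω => ENNReal.ofReal (conj Φ (u n ω)))
    (fun n => ((humod n).trans_lt ENNReal.ofNat_lt_top).ne) hAlim
    (c := fun k => ENNReal.ofReal (1 / (2 * M) ^ k))
    (fun k => ENNReal.ofReal_pos.2 (by positivity)) (fun i j hij => ENNReal.ofReal_le_ofReal
      (one_div_le_one_div_of_le (by positivity) (pow_le_pow_right₀ (by linarith) hij)))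
  obtain ⟨T, hTm, hT, hTle⟩ := hE.exists_bound_average hM hd hpow (fun i => hum (n i))
    (fun i ω => abs_nonneg _) (fun i => humod (n i)) hnA hncross
  set w : ℕ → ℝ := fun k => 1 / (M : ℝ) ^ k with hw
  have hw0 : ∀ k, 0 ≤ w k := fun k => by positivity
  have hwsum : ∀ k, ∑ _i ∈ Finset.Ico k (k + M ^ k), w k = 1 := fun k => by
    rw [Finset.sum_const, Nat.card_Ico, Nat.add_sub_cancel_left, nsmul_eq_mul, hw]
    push_cast
    field_simp
  set g : ℕ → Ω → ℝ := fun k => ∑ i ∈ Finset.Ico k (k + M ^ k), w k • b (n i) with hg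
  have hgD : ∀ k, g k ∈ D := fun k =>
    hconv.sum_mem (fun _ _ => hw0 k) (hwsum k) fun i _ => hb (n i)
  have hgapply : ∀ k ω, g k ω = ∑ i ∈ Finset.Ico k (k + M ^ k), w k • b (n i) ω := fun k ω => by
    simp [hg, Finset.sum_apply]
  have hgm : ∀ k, Measurable (g k) := fun k => by
    rw [funext (hgapply k)]
    exact Finset.measurable_sum _ fun i _ => (hbm (n i)).const_smul (w k)
  have hglim : ∀ᵐ ω ∂P, Tendsto (fun k => g k ω) atTop (𝓝 (x ω)) := by
    filter_upwards [hlim] with ω hω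
    rw [Metric.tendsto_atTop] at hω ⊢
    intro ε hε
    obtain ⟨N, hN⟩ := hω ε hε
    refine ⟨N, fun k hk => ?_⟩
    rw [hgapply]
    exact (convex_ball (x ω) ε).sum_mem (fun _ _ => hw0 k) (hwsum k) fun i hi =>
      hN _ (hk.trans ((Finset.mem_Ico.1 hi).1.trans hn.le_apply))
  obtain ⟨ζ, hζ, hle⟩ := h.exists_dominating (P := P) hgm (l := l / 8) (by positivity)
    (T := fun ω => ENNReal.ofReal (conj Φ (l * x ω)) + T ω)
    ((hE.measurable_ofReal_comp (hx.const_mul l)).add hTm).aemeasurable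
    (by
      rw [lintegral_add_right _ hTm]
      exact ENNReal.add_ne_top.2 ⟨(hxmod.trans_lt ENNReal.one_lt_top).ne, hT⟩)
    (fun k => by
      filter_upwards [hTle k] with ω hω
      have h1 : |l * (g k ω - x ω) / 2| ≤
          (∑ i ∈ Finset.Ico k (k + M ^ k), u (n i) ω) / (M : ℝ) ^ k := by
        have h2 : l * (g k ω - x ω) / 2 =
            (∑ i ∈ Finset.Ico k (k + M ^ k), l * (b (n i) ω - x ω) / 2) / (M : ℝ) ^ k := by
          have h3 : g k ω - x ω = ∑ i ∈ Finset.Ico k (k + M ^ k), w k * (b (n i) ω - x ω) := by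
            simp_rw [mul_sub, Finset.sum_sub_distrib, ← Finset.sum_mul, hwsum, hgapply, one_mul,
              smul_eq_mul]
          rw [h3, Finset.mul_sum, Finset.sum_div, Finset.sum_div]
          refine Finset.sum_congr rfl fun i _ => ?_
          rw [hw]
          ring
        rw [h2, abs_div, abs_of_nonneg (by positivity : (0 : ℝ) ≤ (M : ℝ) ^ k)]
        exact div_le_div_of_nonneg_right (Finset.abs_sum_le_sum_abs _ _) (by positivity)
      have h4 : conj Φ (l * (g k ω - x ω) / 4) ≤
          conj Φ ((∑ i ∈ Finset.Ico k (k + M ^ k), u (n i) ω) / (M : ℝ) ^ k / 2) := by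
        refine hE.mono_abs ?_
        rw [show l * (g k ω - x ω) / 4 = l * (g k ω - x ω) / 2 / 2 by ring, abs_div (_ / 2) (2 : ℝ),
          abs_div (_ / _ ^ k) (2 : ℝ)]
        exact div_le_div_of_nonneg_right (h1.trans (le_abs_self _)) (abs_nonneg _)
      have h5 : conj Φ (l * x ω / 4) ≤ conj Φ (l * x ω) := hE.mono_abs (by
        rw [abs_div, abs_of_pos (by norm_num : (0 : ℝ) < 4)]
        linarith [abs_nonneg (l * x ω)])
      have h6 := hE.map_midpoint_le (l * x ω / 4) (l * (g k ω - x ω) / 4)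
      rw [show (l * x ω / 4 + l * (g k ω - x ω) / 4) / 2 = l / 8 * g k ω by ring] at h6
      refine le_trans ?_ (add_le_add_right hω _)
      rw [← ENNReal.ofReal_add (hE.nonneg _) (hE.nonneg _)]
      refine ENNReal.ofReal_le_ofReal ?_
      have h7 := hE.nonneg (l * x ω / 4)
      have h8 := hE.nonneg (l * (g k ω - x ω) / 4)
      linarith)
  exact hD g x ζ hgD hζ hle hx hglim

end KeyLemma

section KreinSmulian

variable {Ω : Type*} [MeasurableSpace Ω] {P : Measure Ω} {Φ : ℝ → ℝ}

/-- Weak* compactness of the order closed convex subsets of a dual ball, expressed through finite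
intersections of polars. -/
lemma IsYoung.exists_mem_forall_abs_pairing_le [IsProbabilityMeasure P] (h : IsYoung Φ)
    (hΔ : Delta2 Φ) {K S : Set (Ω → ℝ)} {r : ℝ} (hr : 0 < r)
    (hK : K ⊆ polarSet P Φ (modularBall P Φ) r) (hKc : SeqOrderClosed P Φ K) (hKconv : Convex ℝ K)
    (hS : S ⊆ Orlicz P Φ)
    (hfin : ∀ F : Finset (Ω → ℝ), ↑F ⊆ S → (K ∩ polarSet P Φ ↑F 1).Nonempty) :
    ∃ ξ ∈ K, ∀ η ∈ S, |pairing P ξ η| ≤ 1 := by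
  classical
  set D : Finset S → Set (Ω → ℝ) := fun F => K ∩ polarSet P Φ ↑(F.image Subtype.val) 1 with hDdef
  have hsub : ∀ F : Finset S, (↑(F.image Subtype.val) : Set (Ω → ℝ)) ⊆ S := fun F => by
    intro η hη
    obtain ⟨s, -, rfl⟩ := Finset.mem_image.1 (Finset.mem_coe.1 hη)
    exact s.2
  have hmod : ∀ ξ ∈ K, ∫⁻ ω, ENNReal.ofReal (conj Φ (ξ ω / r)) ∂P ≤ 1 := fun ξ hξ =>
    h.lintegral_conj_div_le_one hr (hK hξ)
  have hconv : ∀ F, Convex ℝ (D F) := fun F =>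
    hKconv.inter (h.convex_polarSet ((hsub F).trans hS) 1)
  obtain ⟨x, hx, hlim⟩ := exists_common_limit (P := P) D
    (fun F F' hFF' ξ hξ => ⟨hξ.1, hξ.2.1, fun η hη =>
      hξ.2.2 η (Finset.coe_subset.2 (Finset.image_subset_image hFF') hη)⟩)
    (fun F => hfin _ (hsub F)) hconv (fun ξ hξ => (hK hξ.1).1.1)
    (fun ξ hξ => h.integrable (hK hξ.1).1) (R := r * (1 + Φ 1))
    (fun ξ hξ => h.integral_abs_le hr (hK hξ.1).1.1 (hmod ξ hξ.1))
  have hmem : ∀ F, x ∈ D F := fun F => by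
    obtain ⟨b, hb, hbx⟩ := hlim F
    refine h.mem_of_ae_tendsto hΔ
      (hKc.inter (h.seqOrderClosed_polarSet ((hsub F).trans hS) 1)) (hconv F) hb
      (fun n => (hK (hb n).1).1.1) (inv_pos.2 hr) (fun n => ?_) hx hbx
    simpa only [div_eq_inv_mul] using hmod _ (hb n).1
  refine ⟨x, (hmem ∅).1, fun η hη => (hmem {⟨η, hη⟩}).2.2 η ?_⟩
  simp

/-- The functions `η` with `E[Φ(t η)] ≤ 1` for some `t ≥ n`. -/
def scaledBall (P : Measure Ω) (Φ : ℝ → ℝ) (n : ℕ) : Set (Ω → ℝ) :=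
  {η | Measurable η ∧ ∃ t : ℝ, 0 < t ∧ n ≤ t ∧ ∫⁻ ω, ENNReal.ofReal (Φ (t * η ω)) ∂P ≤ 1}

lemma scaledBall_subset (n : ℕ) : scaledBall P Φ n ⊆ Orlicz P Φ :=
  fun _ hη => ⟨hη.1, hη.2.imp fun _ ht => ⟨ht.1, ht.2.2.trans_lt ENNReal.one_lt_top⟩⟩

lemma mem_polarSet_modularBall {ξ : Ω → ℝ} (hξ : MemOrlicz P (conj Φ) ξ) {n : ℕ}
    (hle : ∀ η ∈ scaledBall P Φ n, |pairing P ξ η| ≤ 1) :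
    ξ ∈ polarSet P Φ (modularBall P Φ) n := by
  refine ⟨hξ, fun η hη => le_of_forall_pos_le_add fun ε hε => ?_⟩
  have ht : (0 : ℝ) < n + ε := by positivity
  have h1 := hle (fun ω => ((n : ℝ) + ε)⁻¹ * η ω) ⟨hη.1.const_mul _, n + ε, ht, by linarith, by
    simpa only [mul_inv_cancel_left₀ ht.ne'] using hη.2⟩
  have h2 : pairing P ξ (fun ω => ((n : ℝ) + ε)⁻¹ * η ω) = ((n : ℝ) + ε)⁻¹ * pairing P ξ η := by
    unfold pairing
    rw [← integral_const_mul]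
    congr 1
    ext ω
    ring
  rw [h2, abs_mul, abs_of_pos (inv_pos.2 ht), inv_mul_le_iff₀ ht, mul_one] at h1
  exact h1

/-- A sequence of finite sets shrinking to zero whose union has a polar disjoint from `C`. -/
lemma IsYoung.exists_finset_seq [IsProbabilityMeasure P] (h : IsYoung Φ) (hΔ : Delta2 Φ)
    {C : Set (Ω → ℝ)} (hC : C ⊆ Orlicz P (conj Φ)) (hconv : Convex ℝ C)
    (hcl : SeqOrderClosed P Φ C) (h0 : (0 : Ω → ℝ) ∉ C) :
    ∃ F : ℕ → Finset (Ω → ℝ), (∀ n, ↑(F n) ⊆ scaledBall P Φ n) ∧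
      ∀ ξ ∈ C, ∃ n, ∃ η ∈ F n, 1 < |pairing P ξ η| := by
  classical
  set Q : ℕ → Finset (Ω → ℝ) → Prop := fun n L => ↑L ⊆ Orlicz P Φ ∧
    ∀ ξ ∈ C, ξ ∈ polarSet P Φ (modularBall P Φ) n → ∃ η ∈ L, 1 < |pairing P ξ η| with hQdef
  have hstep : ∀ n L, ∃ F : Finset (Ω → ℝ), Q n L → ↑F ⊆ scaledBall P Φ n ∧ Q (n + 1) (L ∪ F) := by
    intro n L
    by_contra! hcon
    obtain ⟨hL, hLC⟩ := (hcon ∅).1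
    have hmb := modularBall_subset (P := P) (Φ := Φ)
    obtain ⟨ξ, hξ, hle⟩ := h.exists_mem_forall_abs_pairing_le hΔ
      (K := C ∩ polarSet P Φ (modularBall P Φ) ((n + 1 : ℕ) : ℝ) ∩ polarSet P Φ ↑L 1)
      (S := scaledBall P Φ n) (r := ((n + 1 : ℕ) : ℝ)) (by positivity) (fun ξ hξ => hξ.1.2)
      ((hcl.inter (h.seqOrderClosed_polarSet hmb _)).inter (h.seqOrderClosed_polarSet hL _))
      ((hconv.inter (h.convex_polarSet hmb _)).inter (h.convex_polarSet hL _))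
      (scaledBall_subset n) (fun F hF => by
        have h1 := (hcon F).2 hF
        simp only [hQdef, not_and] at h1
        have h2 := h1 (by
          rw [Finset.coe_union]
          exact union_subset hL (hF.trans (scaledBall_subset n)))
        push Not at h2
        obtain ⟨ξ, hξC, hξB, hξ⟩ := h2
        exact ⟨ξ, ⟨⟨hξC, hξB⟩, hC hξC, fun η hη => hξ η (Finset.mem_union_left _ hη)⟩, hC hξC,
          fun η hη => hξ η (Finset.mem_union_right _ hη)⟩)
    obtain ⟨η, hη, hlt⟩ := hLC ξ hξ.1.1 (mem_polarSet_modularBall hξ.2.1 hle)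
    exact absurd (hξ.2.2 η hη) (not_le.2 hlt)
  choose G hG using hstep
  set L : ℕ → Finset (Ω → ℝ) := fun n => Nat.rec ∅ (fun k L => L ∪ G k L) n with hLdef
  have hLsucc : ∀ n, L (n + 1) = L n ∪ G n (L n) := fun n => rfl
  have hQ : ∀ n, Q n (L n) := by
    intro n
    induction n with
    | zero =>
      refine ⟨by simp [hLdef], fun ξ hξC hξ => absurd ?_ h0⟩
      have hint := h.integrable (hC hξC)
      have h1 : ∫ ω, |ξ ω| ∂P ≤ 0 := by
        refine le_of_forall_pos_le_add fun ε hε => ?_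
        have hΦ1 := h.isEvenConvex.nonneg 1
        have hr : 0 < ε / (1 + Φ 1) := by positivity
        have h2 := h.integral_abs_le hr hξ.1.1 (h.lintegral_conj_div_le_one hr
          ⟨hξ.1, fun η hη => (hξ.2 η hη).trans (by simpa using hr.le)⟩)
        rwa [div_mul_cancel₀ _ (by positivity), ← zero_add ε] at h2
      have h2 : ∀ᵐ ω ∂P, ξ ω = 0 := by
        have := (integral_eq_zero_iff_of_nonneg (fun ω => abs_nonneg (ξ ω)) hint.abs).1
          (le_antisymm h1 (integral_nonneg fun ω => abs_nonneg _))
        filter_upwards [this] with ω hω using abs_eq_zero.1 hω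
      refine hcl (fun _ => ξ) 0 _ (fun _ => hξC) (h.isEvenConvex_conj.memOrlicz_abs (hC hξC))
        (fun _ => Eventually.of_forall fun ω => le_rfl) measurable_zero ?_
      filter_upwards [h2] with ω hω
      simp [hω]
    | succ n ih => exact (hG n (L n) ih).2
  refine ⟨fun n => G n (L n), fun n => (hG n _ (hQ n)).1, fun ξ hξ => ?_⟩
  have hunion : ∀ n, ∀ η ∈ L n, ∃ k, η ∈ G k (L k) := by
    intro n
    induction n with
    | zero => simp [hLdef]
    | succ n ih =>
      intro η hη
      rw [hLsucc] at hη
      exact (Finset.mem_union.1 hη).elim (ih η) fun h => ⟨n, h⟩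
  obtain ⟨c, hc, hle⟩ := h.exists_integral_abs_mul_le (hC hξ)
  obtain ⟨n, hn⟩ := exists_nat_ge c
  obtain ⟨η, hη, hlt⟩ := (hQ n).2 ξ hξ ⟨hC hξ, fun η hη =>
    (abs_integral_le_integral_abs.trans (hle η hη.1 hη.2)).trans hn⟩
  obtain ⟨k, hk⟩ := hunion n η hη
  exact ⟨k, η, hk, hlt⟩

open BoundedContinuousFunction in
/-- A convex set of null families that avoids the unit ball for the supremum norm is separated from
`0` by a summable family. -/
lemma exists_summable_separating {I : Type*} {Z : Set (I → ℝ)} (hZ : Convex ℝ Z)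
    (hlim : ∀ z ∈ Z, Tendsto z cofinite (𝓝 0)) (hlarge : ∀ z ∈ Z, ∃ i, 1 < |z i|) :
    ∃ y : I → ℝ, (Summable fun i => |y i|) ∧ ∃ u > 0, ∀ z ∈ Z, u ≤ ∑' i, y i * z i := by
  classical
  let _ : TopologicalSpace I := ⊥
  have : DiscreteTopology I := ⟨rfl⟩
  obtain ⟨g, u, hgball, hgZ⟩ := geometric_hahn_banach_open (E := I →ᵇ ℝ)
    (t := {w | ⇑w ∈ Z}) (convex_ball 0 1) Metric.isOpen_ball
    (fun w hw w' hw' a b ha hb hab => hZ hw hw' ha hb hab) (by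
    refine Set.disjoint_left.2 fun w hw hwZ => ?_
    obtain ⟨i, hi⟩ := hlarge _ hwZ
    exact absurd (hi.trans_le (w.norm_coe_le_norm i)) (by simpa using (mem_ball_zero_iff.1 hw).le))
  have hu : 0 < u := by simpa using hgball 0 (Metric.mem_ball_self one_pos)
  set e : I → I →ᵇ ℝ := fun i => ofNormedAddCommGroupDiscrete (Pi.single i 1) 1 fun j => by
    rcases eq_or_ne j i with rfl | hj
    · simp
    · simp [hj] with he
  have hsum : ∀ (s : Finset I) (a : I → ℝ) (j : I),
      (∑ i ∈ s, a i • e i) j = if j ∈ s then a j else 0 := fun s a j => by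
    simp [he, Pi.single_apply]
  refine ⟨fun i => g (e i), summable_of_sum_le (c := ‖g‖) (fun i => abs_nonneg _) fun s => ?_,
    u, hu, fun z hz => ?_⟩
  · set a : I → ℝ := fun i => SignType.sign (g (e i)) with ha
    have h1 : ∑ i ∈ s, |g (e i)| = g (∑ i ∈ s, a i • e i) := by
      simp [ha, map_sum, sign_mul_self]
    rw [h1]
    refine (le_abs_self _).trans ((g.le_opNorm _).trans
      (mul_le_of_le_one_right (norm_nonneg _) ?_))
    refine (norm_le zero_le_one).2 fun j => ?_
    rw [hsum]
    split_ifs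
    · rcases lt_trichotomy (g (e j)) 0 with h | h | h <;> simp [ha, h]
    · simp
  · have hbdd : ∃ c, ∀ i, ‖z i‖ ≤ c := by
      have h1 : ∀ᶠ i in cofinite, |z i| ≤ 1 := by
        have := (hlim z hz).abs
        rw [abs_zero] at this
        exact ((tendsto_order.1 this).2 1 one_pos).mono fun i hi => hi.le
      obtain ⟨c, hc⟩ := ((eventually_cofinite.1 h1).image fun i => |z i|).bddAbove
      refine ⟨max c 1, fun i => ?_⟩
      by_cases hi : |z i| ≤ 1
      · exact hi.trans (le_max_right _ _)
      · exact (hc ⟨i, hi, rfl⟩).trans (le_max_left _ _)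
    obtain ⟨c, hc⟩ := hbdd
    set w : I →ᵇ ℝ := ofNormedAddCommGroupDiscrete z c hc with hw
    have hwsum : HasSum (fun i => z i • e i) w := by
      refine Metric.tendsto_atTop.2 fun ε hε => ?_
      have h1 : ∀ᶠ i in cofinite, |z i| < ε / 2 := by
        have := (hlim z hz).abs
        rw [abs_zero] at this
        exact (tendsto_order.1 this).2 _ (half_pos hε)
      refine ⟨(eventually_cofinite.1 h1).toFinset, fun s hs => ?_⟩
      rw [dist_eq_norm]
      refine lt_of_le_of_lt ((norm_le (half_pos hε).le).2 fun j => ?_) (half_lt_self hε)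
      rw [coe_sub, Pi.sub_apply, hsum]
      split_ifs with hj
      · simpa [hw] using (half_pos hε).le
      · have : |z j| < ε / 2 := by
          by_contra hcon
          exact hj (hs ((eventually_cofinite.1 h1).mem_toFinset.2 hcon))
        simpa [hw] using this.le
    have h2 : HasSum (fun i => g (e i) * z i) (g w) := by
      simpa [Function.comp_def, mul_comm] using hwsum.mapL g
    rw [h2.tsum_eq]
    exact hgZ w hz

lemma IsEvenConvex.map_sum_le {f : ℝ → ℝ} (h : IsEvenConvex f) {I : Type*} {s : Finset I}
    {w a : I → ℝ} (hw : ∑ i ∈ s, |w i| ≤ 1) :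
    f (∑ i ∈ s, w i * a i) ≤ ∑ i ∈ s, |w i| * f (a i) := by
  have h1 := h.convexOn.map_add_sum_le (t := s) (w := fun i => |w i|) (p := fun i => |a i|)
    (v := 1 - ∑ i ∈ s, |w i|) (q := 0) (fun i _ => abs_nonneg _) (by ring)
    (fun i _ => mem_univ _) (by linarith) (mem_univ _)
  simp only [smul_eq_mul, mul_zero, zero_add, h.map_zero, h.map_abs] at h1
  refine (h.mono_abs ?_).trans h1
  rw [abs_of_nonneg (a := ∑ i ∈ s, |w i| * |a i|) (by positivity)]
  simpa only [abs_mul] using Finset.abs_sum_le_sum_abs (fun i => w i * a i) s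

lemma IsYoung.exists_pairing_eq_tsum (h : IsYoung Φ) {I : Type*} [Countable I] {y : I → ℝ}
    (hy : Summable fun i => |y i|) {x : I → Ω → ℝ} (hxm : ∀ i, Measurable (x i)) {t : ℝ}
    (ht : 0 < t) (hx : ∀ i, ∫⁻ ω, ENNReal.ofReal (Φ (t * x i ω)) ∂P ≤ 1) :
    ∃ η ∈ Orlicz P Φ, ∀ ξ ∈ Orlicz P (conj Φ), pairing P ξ η = ∑' i, y i * pairing P ξ (x i) := by
  have hE := h.isEvenConvex
  set Y : ℝ := ∑' i, |y i| + 1 with hY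
  have hY0 : 0 < Y := by positivity
  have hYs : ∀ s : Finset I, ∑ i ∈ s, |y i / Y| ≤ 1 := fun s => by
    simp_rw [abs_div, abs_of_pos hY0, ← Finset.sum_div]
    rw [div_le_one hY0]
    exact (hy.sum_le_tsum s fun i _ => abs_nonneg _).trans (by simp [hY])
  set T : Ω → ℝ≥0∞ := fun ω => ∑' i, ENNReal.ofReal |y i / Y| * ENNReal.ofReal (Φ (t * x i ω))
  have hTi : ∀ i, Measurable fun ω => ENNReal.ofReal |y i / Y| * ENNReal.ofReal (Φ (t * x i ω)) :=
    fun i => (hE.measurable_ofReal_comp ((hxm i).const_mul t)).const_mul _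
  have hTm : Measurable T := Measurable.tsum hTi
  have hT : ∫⁻ ω, T ω ∂P ≠ ⊤ := by
    rw [lintegral_tsum fun i => (hTi i).aemeasurable]
    refine ne_top_of_le_ne_top (b := ∑' i, ENNReal.ofReal |y i / Y|) ?_
      (ENNReal.tsum_le_tsum fun i => ?_)
    · refine Summable.tsum_ofReal_ne_top ?_
      simpa only [abs_div] using hy.div_const |Y|
    · rw [lintegral_const_mul _ (hE.measurable_ofReal_comp ((hxm i).const_mul t))]
      exact mul_le_of_le_one_right' (hx i)
  have hTsum : ∀ ω, T ω < ⊤ → ∀ s : Finset I,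
      ∑ i ∈ s, |y i / Y| * Φ (t * x i ω) ≤ (T ω).toReal := fun ω hω s => by
    rw [← ENNReal.ofReal_le_iff_le_toReal hω.ne, ENNReal.ofReal_sum_of_nonneg
      fun i _ => mul_nonneg (abs_nonneg _) (hE.nonneg _)]
    simp_rw [ENNReal.ofReal_mul (abs_nonneg _)]
    exact ENNReal.sum_le_tsum s
  have hsummable : ∀ ω, T ω < ⊤ → Summable fun i => y i / Y * (t * x i ω) := fun ω hω => by
    refine Summable.of_norm_bounded (g := fun i => |y i / Y| * Φ (t * x i ω) +
      |y i / Y| * conj Φ 1) (Summable.add (summable_of_sum_le (fun i =>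
        mul_nonneg (abs_nonneg _) (hE.nonneg _)) (hTsum ω hω)) ?_) fun i => ?_
    · exact (summable_of_sum_le (fun i => abs_nonneg _) hYs).mul_right _
    · rw [Real.norm_eq_abs, abs_mul, ← mul_add]
      have := h.abs_mul_le (t * x i ω) 1
      rw [mul_one] at this
      exact mul_le_mul_of_nonneg_left this (abs_nonneg _)
  refine ⟨fun ω => ∑' i, y i * x i ω, ⟨Measurable.tsum fun i => (hxm i).const_mul _, t / Y,
    by positivity, ?_⟩, fun ξ hξ => ?_⟩
  · refine lt_of_le_of_lt (lintegral_mono_ae ?_) hT.lt_top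
    filter_upwards [ae_lt_top hTm hT] with ω hω
    have h1 : t / Y * ∑' i, y i * x i ω = ∑' i, y i / Y * (t * x i ω) := by
      rw [← tsum_mul_left]
      exact tsum_congr fun i => by ring
    rw [h1]
    refine (ENNReal.ofReal_le_iff_le_toReal hω.ne).2 (le_of_tendsto
      ((hE.continuous.tendsto _).comp (hsummable ω hω).hasSum) (Eventually.of_forall fun s => ?_))
    exact (hE.map_sum_le (hYs s)).trans (hTsum ω hω s)
  · have hxO : ∀ i, MemOrlicz P Φ (x i) := fun i =>
      ⟨hxm i, t, ht, (hx i).trans_lt ENNReal.one_lt_top⟩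
    obtain ⟨c, hc, hle⟩ := h.exists_integral_abs_mul_le hξ
    have hint : ∀ i, Integrable (fun ω => y i * (ξ ω * x i ω)) P := fun i =>
      (h.integrable_mul hξ (hxO i)).const_mul _
    have h1 := hasSum_integral_of_summable_integral_norm hint (by
      refine Summable.of_nonneg_of_le (fun i => by positivity) (fun i => ?_)
        ((hy.mul_right (c / t)))
      simp_rw [Real.norm_eq_abs, abs_mul (y i)]
      rw [integral_const_mul]
      refine mul_le_mul_of_nonneg_left ?_ (abs_nonneg _)
      rw [le_div_iff₀ ht, ← integral_mul_const]
      refine le_trans (le_of_eq ?_) (hle _ ((hxm i).const_mul t) (hx i))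
      congr 1
      ext ω
      rw [← abs_of_pos ht, ← abs_mul, abs_of_pos ht]
      ring_nf)
    unfold pairing
    simp_rw [← integral_const_mul]
    rw [h1.tsum_eq]
    congr 1
    ext ω
    rw [← tsum_mul_left]
    exact tsum_congr fun i => by ring

/-- An order closed convex set that does not contain `0` is strictly separated from `0` by an
element of `L_Φ`. -/
theorem IsYoung.exists_separating [IsProbabilityMeasure P] (h : IsYoung Φ) (hΔ : Delta2 Φ)
    {C : Set (Ω → ℝ)} (hC : C ⊆ Orlicz P (conj Φ)) (hconv : Convex ℝ C)
    (hcl : SeqOrderClosed P Φ C) (h0 : (0 : Ω → ℝ) ∉ C) :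
    ∃ η ∈ Orlicz P Φ, ∃ u > 0, ∀ ξ ∈ C, u ≤ pairing P ξ η := by
  obtain ⟨F, hF, hFC⟩ := h.exists_finset_seq hΔ hC hconv hcl h0
  have hIx : ∀ i : Σ n, F n, Measurable i.2.1 ∧ ∃ t : ℝ, 0 < t ∧ i.1 ≤ t ∧
      ∫⁻ ω, ENNReal.ofReal (Φ (t * i.2.1 ω)) ∂P ≤ 1 := fun i => hF i.1 i.2.2
  choose hxm t ht0 hti htx using hIx
  have htt : Tendsto t cofinite atTop := by
    refine tendsto_atTop.2 fun r => ?_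
    obtain ⟨N, hN⟩ := exists_nat_ge r
    refine ((Finset.range N).sigma fun n => (F n).attach).finite_toSet.subset fun i hi => ?_
    have h1 : t i < r := not_le.1 hi
    have h2 : (i.1 : ℝ) < N := (hti i).trans_lt (h1.trans_le hN)
    simpa using h2
  obtain ⟨t₀, ht₀, ht₀le⟩ : ∃ t₀ > 0, ∀ i, t₀ ≤ t i := by
    have hfin := eventually_cofinite.1 (htt.eventually_ge_atTop 1)
    have h1 : ∀ᶠ ε : ℝ in 𝓝[>] 0, ∀ i ∈ {i | ¬ 1 ≤ t i}, ε ≤ t i :=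
      (eventually_all_finite hfin).2 fun i _ =>
        ((eventually_lt_nhds (ht0 i)).filter_mono nhdsWithin_le_nhds).mono fun _ h => h.le
    obtain ⟨ε, ⟨hε, hε0⟩, hε1⟩ := ((h1.and eventually_mem_nhdsWithin).and
      ((eventually_lt_nhds zero_lt_one).filter_mono nhdsWithin_le_nhds)).exists
    refine ⟨ε, hε0, fun i => ?_⟩
    by_cases hi : 1 ≤ t i
    · exact hε1.le.trans hi
    · exact hε i hi
  have hxt₀ : ∀ i : Σ n, F n, ∫⁻ ω, ENNReal.ofReal (Φ (t₀ * i.2.1 ω)) ∂P ≤ 1 := fun i =>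
    (lintegral_mono fun ω => ENNReal.ofReal_le_ofReal (h.isEvenConvex.mono_abs (by
      rw [abs_mul, abs_mul, abs_of_pos ht₀, abs_of_pos (ht0 i)]
      exact mul_le_mul_of_nonneg_right (ht₀le i) (abs_nonneg _)))).trans (htx i)
  have hxO : ∀ i : Σ n, F n, i.2.1 ∈ Orlicz P Φ := fun i => scaledBall_subset i.1 (hF i.1 i.2.2)
  obtain ⟨y, hy, u, hu, hsep⟩ := exists_summable_separating
    (Z := (fun ξ (i : Σ n, F n) => pairing P ξ i.2.1) '' C) (by
      rintro _ ⟨ξ, hξ, rfl⟩ _ ⟨ζ, hζ, rfl⟩ a b ha hb hab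
      exact ⟨a • ξ + b • ζ, hconv hξ hζ ha hb hab, funext fun i =>
        h.pairing_add_smul (hC hξ) (hC hζ) (hxO i)⟩) (by
      rintro _ ⟨ξ, hξ, rfl⟩
      obtain ⟨c, hc, hle⟩ := h.exists_integral_abs_mul_le (hC hξ)
      refine squeeze_zero_norm (fun i => ?_) (htt.const_div_atTop c)
      rw [Real.norm_eq_abs, le_div_iff₀ (ht0 i)]
      have h1 := abs_integral_le_integral_abs.trans (hle _ ((hxm i).const_mul (t i)) (htx i))
      change |∫ ω, ξ ω * i.2.1 ω ∂P| * t i ≤ c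
      rw [← abs_of_pos (ht0 i), ← abs_mul, ← integral_mul_const]
      refine le_of_eq_of_le ?_ h1
      congr 2
      ext ω
      ring) (by
      rintro _ ⟨ξ, hξ, rfl⟩
      obtain ⟨n, η, hη, hlt⟩ := hFC ξ hξ
      exact ⟨⟨n, η, hη⟩, hlt⟩)
  obtain ⟨η, hη, hpair⟩ := h.exists_pairing_eq_tsum (P := P) hy (x := fun i => i.2.1) hxm ht₀ hxt₀
  refine ⟨η, hη, u, hu, fun ξ hξ => ?_⟩
  rw [hpair ξ (hC hξ)]
  exact hsep _ ⟨ξ, hξ, rfl⟩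

end KreinSmulian

section OrderClosed

variable {Ω : Type*} [MeasurableSpace Ω] {P : Measure Ω} {Φ : ℝ → ℝ} {C : Set (Ω → ℝ)}

lemma tendsto_probDist [IsFiniteMeasure P] {b : ℕ → Ω → ℝ} {g x : Ω → ℝ} (hg : Measurable g)
    (hb : ∀ n, Measurable (b n)) (hlim : ∀ᵐ ω ∂P, Tendsto (fun n => b n ω) atTop (𝓝 (x ω))) :
    Tendsto (fun n => probDist P g (b n)) atTop (𝓝 (probDist P g x)) := by
  refine tendsto_integral_of_dominated_convergence (fun _ => 1)
    (fun n => (integrable_min_abs_sub hg (hb n)).aestronglyMeasurable) (integrable_const _)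
    (fun n => Eventually.of_forall fun ω => ?_) ?_
  · rw [Real.norm_eq_abs, abs_of_nonneg (by positivity)]
    exact min_le_right _ _
  · filter_upwards [hlim] with ω hω
    exact (hω.const_sub _).abs.min tendsto_const_nhds

lemma IsYoung.seqOrderClosed_of_isClosed [IsFiniteMeasure P] (h : IsYoung Φ)
    (hC : C ⊆ Orlicz P (conj Φ))
    (hcl : ∀ ζ : Ω → ℝ, ζ ∈ Orlicz P (conj Φ) → 0 ≤ᵐ[P] ζ →
      @IsClosed _ (probT P (Orlicz P (conj Φ)))
        {ξ : Orlicz P (conj Φ) | ↑ξ ∈ C ∧ ∀ᵐ ω ∂P, |ξ.1 ω| ≤ ζ ω}) :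
    SeqOrderClosed P Φ C := by
  intro b x ζ hb hζ hle hx hlim
  have hxO : x ∈ Orlicz P (conj Φ) := by
    refine h.isEvenConvex_conj.memOrlicz_of_abs_le hζ hx ?_
    filter_upwards [ae_all_iff.2 hle, hlim] with ω h1 h2
    exact le_of_tendsto h2.abs (Eventually.of_forall h1)
  have hζ0 : 0 ≤ᵐ[P] ζ := by
    filter_upwards [hle 0] with ω hω using (abs_nonneg _).trans hω
  refine (@IsClosed.mem_of_tendsto _ (probT P (Orlicz P (conj Φ))) _ ⟨x, hxO⟩ _
    (fun n => ⟨b n, hC (hb n)⟩) atTop _ (hcl ζ hζ hζ0) ?_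
    (Eventually.of_forall fun n => ⟨hb n, hle n⟩)).1
  refine TopologicalSpace.tendsto_nhds_generateFrom_iff.2 ?_
  rintro _ ⟨f, ε, -, rfl⟩ hmem
  exact (tendsto_order.1 (tendsto_probDist f.2.1 (fun n => (hC (hb n)).1) hlim)).2 ε hmem

lemma IsYoung.isClosed_probT_of_isClosed_weakT [IsFiniteMeasure P] (h : IsYoung Φ)
    (hcl : @IsClosed _ (weakT P (Orlicz P (conj Φ)) (Orlicz P Φ))
      {ξ : Orlicz P (conj Φ) | ↑ξ ∈ C}) {ζ : Ω → ℝ} (hζ : ζ ∈ Orlicz P (conj Φ)) :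
    @IsClosed _ (probT P (Orlicz P (conj Φ)))
      {ξ : Orlicz P (conj Φ) | ↑ξ ∈ C ∧ ∀ᵐ ω ∂P, |ξ.1 ω| ≤ ζ ω} := by
  refine (@isOpen_compl_iff _ _ (probT P (Orlicz P (conj Φ)))).1
    ((@isOpen_iff_mem_nhds _ (probT P (Orlicz P (conj Φ))) _).2 fun ξ hξ => ?_)
  by_contra hnhds
  have hball : ∀ j : ℕ, ∃ f : Orlicz P (conj Φ), (↑f ∈ C ∧ ∀ᵐ ω ∂P, |f.1 ω| ≤ ζ ω) ∧
      probDist P ξ.1 f.1 < (1 / 2 : ℝ) ^ j := by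
    intro j
    by_contra! hcon
    refine hnhds ((@mem_nhds_iff _ (probT P (Orlicz P (conj Φ))) _ _).2
      ⟨{g | probDist P ξ.1 g.1 < (1 / 2 : ℝ) ^ j}, fun g hg hgS => absurd hg (not_lt.2
        (hcon g hgS)), TopologicalSpace.isOpen_generateFrom_of_mem ⟨ξ, _, by positivity, rfl⟩, ?_⟩)
    simp [probDist]
  choose f hf hfd using hball
  have hlim : ∀ᵐ ω ∂P, Tendsto (fun j => (f j).1 ω) atTop (𝓝 (ξ.1 ω)) := by
    filter_upwards [ae_summable_abs_sub (a := fun _ => ξ.1) (fun _ => ξ.2.1)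
      (fun j => (f j).2.1) fun j => (hfd j).le] with ω hω
    refine tendsto_iff_dist_tendsto_zero.2 ?_
    simpa only [Real.dist_eq, abs_sub_comm] using hω.tendsto_atTop_zero
  refine hξ ⟨?_, ?_⟩
  · refine @IsClosed.mem_of_tendsto _ (weakT P (Orlicz P (conj Φ)) (Orlicz P Φ)) _ ξ _
      f atTop _ hcl ?_ (Eventually.of_forall fun j => (hf j).1)
    rw [weakT, nhds_induced, tendsto_comap_iff, tendsto_pi_nhds]
    exact fun η => h.tendsto_pairing (fun j => (f j).2.1) hζ (fun j => (hf j).2) hlim η.2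
  · filter_upwards [ae_all_iff.2 fun j => (hf j).2, hlim] with ω h1 h2
    exact le_of_tendsto h2.abs (Eventually.of_forall h1)

lemma IsYoung.isClosed_weakT_of_seqOrderClosed [IsProbabilityMeasure P] (h : IsYoung Φ)
    (hΔ : Delta2 Φ) (hC : C ⊆ Orlicz P (conj Φ)) (hconv : Convex ℝ C)
    (hcl : SeqOrderClosed P Φ C) :
    @IsClosed _ (weakT P (Orlicz P (conj Φ)) (Orlicz P Φ)) {ξ : Orlicz P (conj Φ) | ↑ξ ∈ C} := by
  have hE := h.isEvenConvex_conj
  refine (@isOpen_compl_iff _ _ (weakT P (Orlicz P (conj Φ)) (Orlicz P Φ))).1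
    ((@isOpen_iff_mem_nhds _ (weakT P (Orlicz P (conj Φ)) (Orlicz P Φ)) _).2 fun ξ₀ hξ₀ => ?_)
  have hneg : MemOrlicz P (conj Φ) (-ξ₀.1) := hE.memOrlicz_neg ξ₀.2
  obtain ⟨η, hη, u, hu, hsep⟩ := h.exists_separating hΔ (P := P) (C := (fun ξ => ξ + ξ₀.1) ⁻¹' C)
    (fun ξ hξ => show MemOrlicz P (conj Φ) ξ by
      simpa using hE.memOrlicz_add (hC hξ) hneg)
    (hconv.translate_preimage_left ξ₀.1)
    (fun b x ζ hb hζ hle hx hlim => by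
      refine hcl (fun n => b n + ξ₀.1) (x + ξ₀.1) (ζ + fun ω => |ξ₀.1 ω|) hb
        (hE.memOrlicz_add hζ (hE.memOrlicz_abs ξ₀.2)) (fun n => ?_) (hx.add ξ₀.2.1) ?_
      · filter_upwards [hle n] with ω hω
        exact (abs_add_le _ _).trans (add_le_add_left hω _)
      · filter_upwards [hlim] with ω hω using hω.add_const _)
    (by simpa using hξ₀)
  have hcont : @Continuous _ _ (weakT P (Orlicz P (conj Φ)) (Orlicz P Φ)) _
      fun ξ : Orlicz P (conj Φ) => pairing P ξ.1 η :=
    @Continuous.comp _ _ _ (weakT P (Orlicz P (conj Φ)) (Orlicz P Φ)) _ _ _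
      (fun q : Orlicz P Φ → ℝ => q ⟨η, hη⟩) (continuous_apply _) continuous_induced_dom
  refine (@mem_nhds_iff _ (weakT P (Orlicz P (conj Φ)) (Orlicz P Φ)) _ _).2
    ⟨{ξ | pairing P ξ.1 η < pairing P ξ₀.1 η + u}, fun ξ hξ hξC => ?_,
      @IsOpen.preimage _ _ (weakT P (Orlicz P (conj Φ)) (Orlicz P Φ)) _ _ hcont _ isOpen_Iio, ?_⟩
  · have h1 := hsep (ξ.1 + -ξ₀.1) (by simpa using hξC)
    have h2 := h.pairing_add_smul (a := 1) (b := -1) ξ.2 ξ₀.2 hη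
    rw [one_smul, neg_one_smul] at h2
    have h3 : pairing P ξ.1 η < pairing P ξ₀.1 η + u := hξ
    linarith
  · simpa using hu

end OrderClosed

/-- If `Φ ∈ Δ₂`, a convex `C ⊆ L_{Φ*}` is
`σ(L_{Φ*},L_Φ)`-closed iff for every `0 ≤ ζ ∈ L_{Φ*}`, the set
`C ∩ [-ζ,ζ]` is closed for the topology of convergence in probability
(i.e. `C` is order closed). -/
theorem statement14
    {Ω : Type*} [MeasurableSpace Ω] (P : Measure Ω) [IsProbabilityMeasure P]
    (Φ : ℝ → ℝ) (hΦ : IsYoung Φ) (hΔ : Delta2 Φ)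
    (C : Set (Ω → ℝ)) (hC : C ⊆ Orlicz P (conj Φ)) (hconv : Convex ℝ C) :
    @IsClosed _ (weakT P (Orlicz P (conj Φ)) (Orlicz P Φ))
        {ξ : Orlicz P (conj Φ) | ↑ξ ∈ C} ↔
      ∀ ζ : Ω → ℝ, ζ ∈ Orlicz P (conj Φ) → 0 ≤ᵐ[P] ζ →
        @IsClosed _ (probT P (Orlicz P (conj Φ)))
          {ξ : Orlicz P (conj Φ) | ↑ξ ∈ C ∧ ∀ᵐ ω ∂P, |ξ.1 ω| ≤ ζ ω} := by
  refine ⟨fun hcl ζ hζ _ => hΦ.isClosed_probT_of_isClosed_weakT hcl hζ, fun hcl => ?_⟩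
  exact hΦ.isClosed_weakT_of_seqOrderClosed hΔ hC hconv (hΦ.seqOrderClosed_of_isClosed hC hcl)

end OrliczPaper
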